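/- arXiv:2408.12697 — 9 statements merged into one kernel-verified Lean document; each statement's English description precedes it below -/
import Mathlib

section
/- For every λ ∈ ℂ with Re λ > d and every x ∈ D(B*), one has Re(s(λ)[x]) ≥ (a − Re λ)‖x‖² + (Re λ − d)‖(D − λ)⁻¹B*x‖²; in particular Re(s(λ)[x]) ≥ (a − Re λ)‖x‖². -/
open scoped ComplexInnerProductSpace

/-- The Schur complement quadratic form
`s(λ)[x] = ⟨(A − λ)x, x⟩ − ⟨(D − λ)⁻¹ B*x, B*x⟩` for `x ∈ D(B*)`. -/
noncomputable def schurForm {H : Type*} [NormedAddCommGroup H] [InnerProductSpace ℂ H]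
    [CompleteSpace H] (A D : H →L[ℂ] H) (B : H →ₗ.[ℂ] H) (lam : ℂ)
    (x : B.adjoint.domain) : ℂ :=
  ⟪(A - lam • (1 : H →L[ℂ] H)) (x : H), (x : H)⟫
    - ⟪(Ring.inverse (D - lam • (1 : H →L[ℂ] H))) (B.adjoint x), B.adjoint x⟫

theorem stmt0 {H : Type*} [NormedAddCommGroup H] [InnerProductSpace ℂ H] [CompleteSpace H]
    (A D : H →L[ℂ] H) (hA : IsSelfAdjoint A) (hD : IsSelfAdjoint D)
    (B : H →ₗ.[ℂ] H) (hBdense : Dense (B.domain : Set H)) (hBclosed : B.IsClosed)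
    (a d : ℝ)
    (ha : a = sInf {r : ℝ | (r : ℂ) ∈ spectrum ℂ A})
    (hd : d = sSup {r : ℝ | (r : ℂ) ∈ spectrum ℂ D})
    (hda : d < a)
    (lam : ℂ) (hlam : d < lam.re) (x : B.adjoint.domain) :
    (a - lam.re) * ‖(x : H)‖ ^ 2
        + (lam.re - d) * ‖(Ring.inverse (D - lam • (1 : H →L[ℂ] H))) (B.adjoint x)‖ ^ 2
      ≤ (schurForm A D B lam x).re
    ∧ (a - lam.re) * ‖(x : H)‖ ^ 2 ≤ (schurForm A D B lam x).re := by
  have hsetA : {r : ℝ | (r : ℂ) ∈ spectrum ℂ A} = spectrum ℝ A := by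
    ext r
    exact spectrum.algebraMap_mem_iff ℂ (r := r) (a := A)
  have hsetD : {r : ℝ | (r : ℂ) ∈ spectrum ℂ D} = spectrum ℝ D := by
    ext r
    exact spectrum.algebraMap_mem_iff ℂ (r := r) (a := D)
  rw [hsetA] at ha
  rw [hsetD] at hd
  have hAle : algebraMap ℝ (H →L[ℂ] H) a ≤ A := by
    rw [algebraMap_le_iff_le_spectrum hA]
    intro r hr
    rw [ha]
    exact csInf_le (spectrum.isCompact (𝕜 := ℝ) A).bddBelow hr
  have hDle : D ≤ algebraMap ℝ (H →L[ℂ] H) d := by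
    rw [le_algebraMap_iff_spectrum_le hD]
    intro r hr
    rw [hd]
    exact le_csSup (spectrum.isCompact (𝕜 := ℝ) D).bddAbove hr
  have hAx : ∀ y : H, a * ‖y‖ ^ 2 ≤ (⟪A y, y⟫).re := by
    intro y
    have h := (ContinuousLinearMap.le_def _ _).1 hAle
    have h2 := h.re_inner_nonneg_left y
    simp [Algebra.algebraMap_eq_smul_one, inner_sub_left, inner_smul_left_eq_smul,
      inner_self_eq_norm_sq_to_K, ← Complex.ofReal_pow] at h2
    exact h2
  have hDx : ∀ y : H, (⟪y, D y⟫).re ≤ d * ‖y‖ ^ 2 := by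
    intro y
    have h := (ContinuousLinearMap.le_def _ _).1 hDle
    have h2 := h.re_inner_nonneg_right y
    simp [Algebra.algebraMap_eq_smul_one, inner_sub_right, inner_smul_right_eq_smul,
      inner_self_eq_norm_sq_to_K, ← Complex.ofReal_pow] at h2
    exact h2
  have hunit : IsUnit (D - lam • (1 : H →L[ℂ] H)) := by
    by_contra hn
    have hmem : lam ∈ spectrum ℂ D := by
      rw [spectrum.mem_iff, Algebra.algebraMap_eq_smul_one, ← IsUnit.neg_iff, neg_sub]
      exact hn
    have hre := hD.mem_spectrum_eq_re hmem
    have h1 : lam.re ∈ spectrum ℝ D := by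
      rw [← hsetD]
      show ((lam.re : ℝ) : ℂ) ∈ spectrum ℂ D
      rw [← hre]
      exact hmem
    have h2 := le_csSup (spectrum.isCompact (𝕜 := ℝ) D).bddAbove h1
    rw [← hd] at h2
    linarith
  have key : (a - lam.re) * ‖(x : H)‖ ^ 2
        + (lam.re - d) * ‖(Ring.inverse (D - lam • (1 : H →L[ℂ] H))) (B.adjoint x)‖ ^ 2
      ≤ (schurForm A D B lam x).re := by
    unfold schurForm
    generalize B.adjoint x = w
    obtain ⟨y, hy⟩ : ∃ y, y = (Ring.inverse (D - lam • (1 : H →L[ℂ] H))) w := ⟨_, rfl⟩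
    have hw : w = (D - lam • (1 : H →L[ℂ] H)) y := by
      rw [hy, ← ContinuousLinearMap.mul_apply, Ring.mul_inverse_cancel _ hunit]
      rfl
    rw [← hy, hw]
    have e1 := hAx (x : H)
    have e2 := hDx y
    simp [inner_sub_left, inner_sub_right, inner_smul_left, inner_smul_right,
      inner_self_eq_norm_sq_to_K, ← Complex.ofReal_pow]
    linarith
  refine ⟨key, le_trans ?_ key⟩
  have : 0 ≤ (lam.re - d) * ‖(Ring.inverse (D - lam • (1 : H →L[ℂ] H))) (B.adjoint x)‖ ^ 2 :=
    mul_nonneg (by linarith) (by positivity)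
  linarith
end

section
/- For real λ the number s(λ)[x] is real, and for all real d < μ < λ and every x ∈ D(B*), s(λ)[x] − s(μ)[x] ≤ (μ − λ)‖x‖²; consequently, for every x ∈ D(B*) with x ≠ 0 the function λ ↦ s(λ)[x] is strictly decreasing on (d, ∞). -/
open scoped ComplexInnerProductSpace

theorem schur_aux {H : Type*} [NormedAddCommGroup H] [InnerProductSpace ℂ H] [CompleteSpace H]
    (D : H →L[ℂ] H) (hD : IsSelfAdjoint D) (d : ℝ)
    (hd : d = sSup {r : ℝ | (r : ℂ) ∈ spectrum ℂ D}) (mu : ℝ) (hmu : d < mu) :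
    IsUnit (D - (mu : ℂ) • (1 : H →L[ℂ] H)) ∧
    ∀ u : H, (⟪(D - (mu : ℂ) • (1 : H →L[ℂ] H)) u, u⟫).re ≤ 0 := by
  have hset : {r : ℝ | (r : ℂ) ∈ spectrum ℂ D} = spectrum ℝ D := by
    ext r
    exact spectrum.algebraMap_mem_iff (R := ℝ) ℂ
  have hb : BddAbove {r : ℝ | (r : ℂ) ∈ spectrum ℂ D} := by
    rw [hset]
    exact (spectrum.isCompact D).bddAbove
  have hle : ∀ r ∈ spectrum ℝ D, r ≤ d := by
    intro r hr
    rw [hd]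
    exact le_csSup hb (hset ▸ hr)
  constructor
  · have h1 : mu ∉ spectrum ℝ D := fun h => absurd (hle mu h) (not_le.mpr hmu)
    have h2 : (mu : ℂ) ∉ spectrum ℂ D := fun h => h1 (hset ▸ h)
    have h3 := spectrum.notMem_iff.mp h2
    rw [Algebra.algebraMap_eq_smul_one] at h3
    rw [← neg_sub]
    exact h3.neg
  · intro u
    have h : D ≤ algebraMap ℝ (H →L[ℂ] H) mu :=
      le_algebraMap_of_spectrum_le (fun r hr => (hle r hr).trans hmu.le) hD
    rw [ContinuousLinearMap.le_def] at h
    have h2 := h.inner_nonneg_left u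
    have h3 := (Complex.le_def.mp h2).1
    have e : (D - (mu : ℂ) • (1 : H →L[ℂ] H)) = - (algebraMap ℝ (H →L[ℂ] H) mu - D) := by
      rw [neg_sub, Algebra.algebraMap_eq_smul_one]
      congr 1
    rw [e]
    simp only [ContinuousLinearMap.neg_apply, inner_neg_left, Complex.neg_re]
    simpa using h3

theorem sa_sub {H : Type*} [NormedAddCommGroup H] [InnerProductSpace ℂ H] [CompleteSpace H]
    (D : H →L[ℂ] H) (hD : IsSelfAdjoint D) (mu : ℝ) (u v : H) :
    ⟪(D - (mu : ℂ) • (1 : H →L[ℂ] H)) u, v⟫ = ⟪u, (D - (mu : ℂ) • (1 : H →L[ℂ] H)) v⟫ := by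
  have h : ⟪D u, v⟫ = ⟪u, D v⟫ := hD.isSymmetric u v
  simp [inner_sub_left, inner_sub_right, inner_smul_left, inner_smul_right, h]

theorem im_zero {H : Type*} [NormedAddCommGroup H] [InnerProductSpace ℂ H] [CompleteSpace H]
    (D : H →L[ℂ] H) (hD : IsSelfAdjoint D) (mu : ℝ) (u : H) :
    (⟪(D - (mu : ℂ) • (1 : H →L[ℂ] H)) u, u⟫).im = 0 := by
  apply Complex.conj_eq_iff_im.mp
  rw [inner_conj_symm, sa_sub D hD]

theorem res_aux {H : Type*} [NormedAddCommGroup H] [InnerProductSpace ℂ H] [CompleteSpace H]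
    (D : H →L[ℂ] H) (hD : IsSelfAdjoint D) (d : ℝ)
    (hd : d = sSup {r : ℝ | (r : ℂ) ∈ spectrum ℂ D}) (mu lam : ℝ) (hmu : d < mu)
    (hl : mu < lam) (y : H) :
    (⟪(Ring.inverse (D - (mu : ℂ) • (1 : H →L[ℂ] H))) y, y⟫).re ≤
      (⟪(Ring.inverse (D - (lam : ℂ) • (1 : H →L[ℂ] H))) y, y⟫).re := by
  obtain ⟨um, pm⟩ := schur_aux D hD d hd mu hmu
  obtain ⟨ul, -⟩ := schur_aux D hD d hd lam (hmu.trans hl)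
  have sm := sa_sub D hD mu
  have hrel : ∀ w : H, (D - (lam : ℂ) • (1 : H →L[ℂ] H)) w
      = (D - (mu : ℂ) • (1 : H →L[ℂ] H)) w - ((lam - mu : ℝ) : ℂ) • w := by
    intro w
    simp [sub_smul]
  set M := D - (mu : ℂ) • (1 : H →L[ℂ] H)
  set L := D - (lam : ℂ) • (1 : H →L[ℂ] H)
  have cM : ∀ w, M (Ring.inverse M w) = w := fun w =>
    DFunLike.congr_fun (Ring.mul_inverse_cancel M um) w
  have cM' : ∀ w, Ring.inverse M (M w) = w := fun w =>
    DFunLike.congr_fun (Ring.inverse_mul_cancel M um) w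
  have cL : ∀ w, L (Ring.inverse L w) = w := fun w =>
    DFunLike.congr_fun (Ring.mul_inverse_cancel L ul) w
  have cL' : ∀ w, Ring.inverse L (L w) = w := fun w =>
    DFunLike.congr_fun (Ring.inverse_mul_cancel L ul) w
  set u := Ring.inverse L (Ring.inverse M y) with hu
  have hLu : L u = Ring.inverse M y := cL _
  have hML : M (L u) = y := by rw [hLu, cM]
  have hcomm : L (M u) = y := by
    rw [← hML, hrel, hrel]
    simp
  have hRl : Ring.inverse L y = M u := by rw [← hcomm, cL']
  rw [hRl, ← hLu]
  have hdiff : L u = M u - ((lam - mu : ℝ) : ℂ) • u := hrel u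
  have key : 0 ≤ (⟪u, y⟫).re := by
    rw [← hML, ← sm, hdiff, inner_sub_right, inner_smul_right, Complex.sub_re,
      Complex.re_ofReal_mul]
    have h1 : 0 ≤ (⟪M u, M u⟫).re := inner_self_nonneg (𝕜 := ℂ)
    have h2 := pm u
    nlinarith
  rw [hdiff, inner_sub_left, inner_smul_left, Complex.conj_ofReal, Complex.sub_re,
    Complex.re_ofReal_mul]
  nlinarith

theorem stmt1 {H : Type*} [NormedAddCommGroup H] [InnerProductSpace ℂ H] [CompleteSpace H]
    (A D : H →L[ℂ] H) (hA : IsSelfAdjoint A) (hD : IsSelfAdjoint D)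
    (B : H →ₗ.[ℂ] H) (hBdense : Dense (B.domain : Set H)) (hBclosed : B.IsClosed)
    (a d : ℝ)
    (ha : a = sInf {r : ℝ | (r : ℂ) ∈ spectrum ℂ A})
    (hd : d = sSup {r : ℝ | (r : ℂ) ∈ spectrum ℂ D})
    (hda : d < a)
    (x : B.adjoint.domain) :
    (∀ lam : ℝ, d < lam → (schurForm A D B (lam : ℂ) x).im = 0)
    ∧ (∀ mu lam : ℝ, d < mu → mu < lam →
        (schurForm A D B (lam : ℂ) x).re - (schurForm A D B (mu : ℂ) x).re
          ≤ (mu - lam) * ‖(x : H)‖ ^ 2)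
    ∧ ((x : H) ≠ 0 →
        StrictAntiOn (fun lam : ℝ => (schurForm A D B (lam : ℂ) x).re) (Set.Ioi d)) := by
  have main : ∀ mu lam : ℝ, d < mu → mu < lam →
        (schurForm A D B (lam : ℂ) x).re - (schurForm A D B (mu : ℂ) x).re
          ≤ (mu - lam) * ‖(x : H)‖ ^ 2 := by
    intro mu lam hmu hl
    have h := res_aux D hD d hd mu lam hmu hl (B.adjoint x)
    have hx : (⟪(x : H), (x : H)⟫).re = ‖(x : H)‖ ^ 2 :=
      inner_self_eq_norm_sq (𝕜 := ℂ) (x : H)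
    have e : ∀ r : ℝ, (⟪(A - (r : ℂ) • (1 : H →L[ℂ] H)) (x : H), (x : H)⟫).re
        = (⟪A (x : H), (x : H)⟫).re - r * ‖(x : H)‖ ^ 2 := by
      intro r
      rw [← hx, ContinuousLinearMap.sub_apply, ContinuousLinearMap.smul_apply,
        ContinuousLinearMap.one_apply, inner_sub_left, inner_smul_left, Complex.conj_ofReal,
        Complex.sub_re, Complex.re_ofReal_mul]
    unfold schurForm
    rw [Complex.sub_re, Complex.sub_re, e, e]
    linarith
  refine ⟨?_, main, ?_⟩
  · intro lam hl
    obtain ⟨ul, -⟩ := schur_aux D hD d hd lam hl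
    unfold schurForm
    rw [Complex.sub_im, im_zero A hA, zero_sub, neg_eq_zero]
    have c : (D - (lam : ℂ) • (1 : H →L[ℂ] H))
        (Ring.inverse (D - (lam : ℂ) • (1 : H →L[ℂ] H)) (B.adjoint x)) = B.adjoint x :=
      DFunLike.congr_fun (Ring.mul_inverse_cancel _ ul) (B.adjoint x)
    have h := im_zero D hD lam (Ring.inverse (D - (lam : ℂ) • (1 : H →L[ℂ] H)) (B.adjoint x))
    rw [sa_sub D hD, c] at h
    exact h
  · intro hx mu hmu lam _ hl
    have h := main mu lam hmu hl
    have hp : 0 < ‖(x : H)‖ ^ 2 := by positivity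
    show (schurForm A D B (lam : ℂ) x).re < (schurForm A D B (mu : ℂ) x).re
    nlinarith
end

section
/- For every real λ ∈ (d, a), the operator 𝒯 − λ is a bijection from D(B*) ⊕ D(B) onto H ⊕ H; in particular the interval (d, a) is contained in the resolvent set of 𝒯. -/
open scoped InnerProductSpace NNReal in
theorem aux_lower {H : Type*} [NormedAddCommGroup H] [InnerProductSpace ℂ H] [CompleteSpace H]
    (A : H →L[ℂ] H) (hA : IsSelfAdjoint A) (r : ℝ)
    (h : ∀ s : ℝ, (s : ℂ) ∈ spectrum ℂ A → r ≤ s) (x : H) :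
    r * ‖x‖ ^ 2 ≤ (⟪A x, x⟫_ℂ).re := by
  have h1 : algebraMap ℝ (H →L[ℂ] H) r ≤ A := by
    apply algebraMap_le_of_le_spectrum (ha := hA)
    intro s hs
    exact h s (spectrum.algebraMap_mem ℂ hs)
  rw [ContinuousLinearMap.le_def] at h1
  have h2 := h1.re_inner_nonneg_left x
  have h5 : (A - algebraMap ℝ (H →L[ℂ] H) r) x = A x - (r : ℂ) • x := by
    simp [Algebra.algebraMap_eq_smul_one]
  have h3 : (⟪(r : ℂ) • x, x⟫_ℂ).re = r * ‖x‖ ^ 2 := by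
    rw [inner_smul_left, inner_self_eq_norm_sq_to_K, Complex.conj_ofReal, Complex.re_ofReal_mul]
    norm_cast
  have h6 : 0 ≤ (⟪A x - (r : ℂ) • x, x⟫_ℂ).re := h5 ▸ h2
  rw [inner_sub_left, Complex.sub_re, h3] at h6
  linarith

open scoped InnerProductSpace NNReal in
theorem aux_unit {E : Type*} [NormedAddCommGroup E] [InnerProductSpace ℂ E] [CompleteSpace E]
    (P : E →L[ℂ] E) (c : ℝ) (hc : 0 < c) (h : ∀ x, c * ‖x‖ ^ 2 ≤ (⟪P x, x⟫_ℂ).re) :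
    IsUnit P := by
  refine P.isUnit_of_forall_le_norm_inner_map (c := ⟨c, hc.le⟩) hc fun x => ?_
  have := h x
  have h2 := Complex.re_le_norm (⟪P x, x⟫_ℂ)
  change ‖x‖ ^ 2 * c ≤ _
  linarith

open scoped InnerProductSpace NNReal in
theorem aux_surj {H : Type*} [NormedAddCommGroup H] [InnerProductSpace ℂ H] [CompleteSpace H]
    (P Q : H →L[ℂ] H) (B : H →ₗ.[ℂ] H) (hBdense : Dense (B.domain : Set H))
    (hBclosed : B.IsClosed) (α δ : ℝ) (hα : 0 < α) (hδ : 0 < δ)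
    (hP : ∀ x, α * ‖x‖ ^ 2 ≤ (⟪P x, x⟫_ℂ).re) (hQ : ∀ x, δ * ‖x‖ ^ 2 ≤ (⟪Q x, x⟫_ℂ).re)
    (f g : H) : ∃ (x : B.adjoint.domain) (y : B.domain),
      P (x : H) + B y = f ∧ B.adjoint x - Q (y : H) = g := by
  obtain ⟨u, hu⟩ := aux_unit P α hα hP
  set R : H →L[ℂ] H := ↑u⁻¹ with hR
  have hPR : ∀ w, P (R w) = w := fun w => by
    have : P * R = 1 := by rw [← hu, hR]; exact u.mul_inv
    exact congrArg (fun T : H →L[ℂ] H => T w) this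
  set β : ℝ := α / (‖P‖ + 1) ^ 2 with hβ
  have hβ0 : 0 < β := by positivity
  have hRc : ∀ w, β * ‖w‖ ^ 2 ≤ (⟪R w, w⟫_ℂ).re := by
    intro w
    have h1 := hP (R w)
    rw [hPR] at h1
    have h2 : (⟪R w, w⟫_ℂ).re = (⟪w, R w⟫_ℂ).re := inner_re_symm (𝕜 := ℂ) _ _
    have h3 : ‖w‖ ≤ (‖P‖ + 1) * ‖R w‖ := by
      have := P.le_opNorm (R w)
      rw [hPR] at this
      nlinarith [norm_nonneg (R w)]
    have h4 : ‖w‖ ^ 2 ≤ (‖P‖ + 1) ^ 2 * ‖R w‖ ^ 2 := by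
      rw [← mul_pow]; gcongr
    rw [h2]
    refine le_trans ?_ h1
    rw [hβ, div_mul_eq_mul_div, div_le_iff₀ (by positivity)]
    nlinarith
  let e := WithLp.prodContinuousLinearEquiv 2 ℂ H H
  let Γ : Submodule ℂ (WithLp 2 (H × H)) := B.graph.comap (e : WithLp 2 (H × H) →ₗ[ℂ] H × H)
  have hΓ : IsClosed (Γ : Set (WithLp 2 (H × H))) :=
    IsClosed.preimage e.continuous hBclosed
  haveI : CompleteSpace Γ := hΓ.completeSpace_coe
  let M : WithLp 2 (H × H) →L[ℂ] WithLp 2 (H × H) :=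
    (e.symm : H × H →L[ℂ] WithLp 2 (H × H)) ∘L (Q.prodMap R) ∘L
      (e : WithLp 2 (H × H) →L[ℂ] H × H)
  have hM1 : ∀ v, (M v).fst = Q v.fst := fun v => rfl
  have hM2 : ∀ v, (M v).snd = R v.snd := fun v => rfl
  let S : Γ →L[ℂ] Γ := ContinuousLinearMap.adjoint Γ.subtypeL ∘L M ∘L Γ.subtypeL
  have hS : ∀ v w : Γ, ⟪S v, w⟫_ℂ = ⟪M (v : WithLp 2 (H × H)), (w : WithLp 2 (H × H))⟫_ℂ := by
    intro v w
    exact ContinuousLinearMap.adjoint_inner_left Γ.subtypeL w (M v)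
  have hSc : ∀ v : Γ, min δ β * ‖v‖ ^ 2 ≤ (⟪S v, v⟫_ℂ).re := by
    intro v
    rw [hS]
    have h1 := hQ (v : WithLp 2 (H × H)).fst
    have h2 := hRc (v : WithLp 2 (H × H)).snd
    have h3 : ‖v‖ ^ 2 = ‖(v : WithLp 2 (H × H)).fst‖ ^ 2 + ‖(v : WithLp 2 (H × H)).snd‖ ^ 2 :=
      WithLp.prod_norm_sq_eq_of_L2 (v : WithLp 2 (H × H))
    have h4 : ⟪M (v : WithLp 2 (H × H)), (v : WithLp 2 (H × H))⟫_ℂ =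
      ⟪Q (v : WithLp 2 (H × H)).fst, (v : WithLp 2 (H × H)).fst⟫_ℂ +
      ⟪R (v : WithLp 2 (H × H)).snd, (v : WithLp 2 (H × H)).snd⟫_ℂ := rfl
    rw [h4, Complex.add_re, h3]
    nlinarith [min_le_left δ β, min_le_right δ β,
      mul_le_mul_of_nonneg_right (min_le_left δ β) (sq_nonneg ‖(v : WithLp 2 (H × H)).fst‖),
      mul_le_mul_of_nonneg_right (min_le_right δ β) (sq_nonneg ‖(v : WithLp 2 (H × H)).snd‖)]
  have hSu := aux_unit S (min δ β) (lt_min hδ hβ0) hSc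
  obtain ⟨γ, hγ⟩ := (ContinuousLinearMap.isUnit_iff_bijective.mp hSu).2
    (ContinuousLinearMap.adjoint Γ.subtypeL (WithLp.toLp 2 (-g, R f)))
  obtain ⟨y, hy1, hy2⟩ := (B.mem_graph_iff).mp γ.2
  have hy1 : (y : H) = (γ : WithLp 2 (H × H)).fst := hy1
  have hy2 : B y = (γ : WithLp 2 (H × H)).snd := hy2
  have key : ∀ z : B.domain, ⟪g + Q (y : H), (z : H)⟫_ℂ = ⟪R (f - B y), B z⟫_ℂ := by
    intro z
    let w : Γ := ⟨WithLp.toLp 2 ((z : H), B z), B.mem_graph z⟩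
    have h1 := hS γ w
    rw [hγ, ContinuousLinearMap.adjoint_inner_left] at h1
    have h2 : ⟪-g, (z : H)⟫_ℂ + ⟪R f, B z⟫_ℂ =
      ⟪Q (γ : WithLp 2 (H × H)).fst, (z : H)⟫_ℂ + ⟪R (γ : WithLp 2 (H × H)).snd, B z⟫_ℂ := h1
    rw [← hy1, ← hy2, inner_neg_left] at h2
    rw [map_sub, inner_sub_left, inner_add_left]
    linear_combination -h2
  have hx : R (f - B y) ∈ B.adjoint.domain :=
    LinearPMap.mem_adjoint_domain_of_exists _ ⟨_, key⟩
  refine ⟨⟨_, hx⟩, y, ?_, ?_⟩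
  · simp [hPR]
  · rw [LinearPMap.adjoint_apply_eq hBdense ⟨_, hx⟩ key]; simp

open scoped InnerProductSpace NNReal in
theorem stmt5 {H : Type*} [NormedAddCommGroup H] [InnerProductSpace ℂ H] [CompleteSpace H]
    (A D : H →L[ℂ] H) (hA : IsSelfAdjoint A) (hD : IsSelfAdjoint D)
    (B : H →ₗ.[ℂ] H) (hBdense : Dense (B.domain : Set H)) (hBclosed : B.IsClosed)
    (a d : ℝ)
    (ha : a = sInf {r : ℝ | (r : ℂ) ∈ spectrum ℂ A})
    (hd : d = sSup {r : ℝ | (r : ℂ) ∈ spectrum ℂ D})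
    (hda : d < a)
    (lam : ℝ) (hlam₁ : d < lam) (hlam₂ : lam < a) :
    Function.Bijective (fun p : B.adjoint.domain × B.domain =>
      ((A (p.1 : H) + B p.2 - (lam : ℂ) • (p.1 : H),
        B.adjoint p.1 + D (p.2 : H) - (lam : ℂ) • (p.2 : H)) : H × H)) := by
  have hbd : ∀ (T : H →L[ℂ] H) (s : ℝ), (s : ℂ) ∈ spectrum ℂ T → |s| ≤ ‖T‖ * ‖(1 : H →L[ℂ] H)‖ := by
    intro T s hs
    have := spectrum.norm_le_norm_mul_of_mem hs
    simpa using this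
  have hA1 : ∀ x, a * ‖x‖ ^ 2 ≤ (⟪A x, x⟫_ℂ).re := by
    apply aux_lower A hA
    intro s hs
    rw [ha]
    exact csInf_le ⟨-(‖A‖ * ‖(1 : H →L[ℂ] H)‖), fun t ht => (abs_le.mp (hbd A t ht)).1⟩ hs
  have hD1 : ∀ x, (-d) * ‖x‖ ^ 2 ≤ (⟪(-D) x, x⟫_ℂ).re := by
    apply aux_lower (-D) hD.neg
    intro s hs
    have hs' : ((-s : ℝ) : ℂ) ∈ spectrum ℂ D := by
      rw [← spectrum.neg_eq, Set.mem_neg] at hs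
      push_cast; exact hs
    have : -s ≤ d := by
      rw [hd]
      exact le_csSup ⟨‖D‖ * ‖(1 : H →L[ℂ] H)‖, fun t ht => (abs_le.mp (hbd D t ht)).2⟩ hs'
    linarith
  have hns : ∀ x : H, (⟪(lam : ℂ) • x, x⟫_ℂ).re = lam * ‖x‖ ^ 2 := by
    intro x
    rw [inner_smul_left, inner_self_eq_norm_sq_to_K, Complex.conj_ofReal, Complex.re_ofReal_mul]
    norm_cast
  set P : H →L[ℂ] H := A - (lam : ℂ) • 1 with hPd
  set Q : H →L[ℂ] H := (lam : ℂ) • 1 - D with hQd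
  have hPx : ∀ x, P x = A x - (lam : ℂ) • x := fun x => rfl
  have hQx : ∀ x, Q x = (lam : ℂ) • x - D x := fun x => rfl
  have hP : ∀ x, (a - lam) * ‖x‖ ^ 2 ≤ (⟪P x, x⟫_ℂ).re := by
    intro x
    rw [hPx, inner_sub_left, Complex.sub_re, hns]
    linarith [hA1 x]
  have hQ : ∀ x, (lam - d) * ‖x‖ ^ 2 ≤ (⟪Q x, x⟫_ℂ).re := by
    intro x
    rw [hQx, inner_sub_left, Complex.sub_re, hns]
    have := hD1 x
    rw [ContinuousLinearMap.neg_apply, inner_neg_left, Complex.neg_re] at this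
    linarith
  have ha0 : 0 < a - lam := by linarith
  have hd0 : 0 < lam - d := by linarith
  have hform : ∀ (x : B.adjoint.domain) (y : B.domain),
      ((A (x : H) + B y - (lam : ℂ) • (x : H),
        B.adjoint x + D (y : H) - (lam : ℂ) • (y : H)) : H × H) =
      (P (x : H) + B y, B.adjoint x - Q (y : H)) := by
    intro x y
    rw [hPx, hQx]
    ext1
    · simp only []; abel
    · simp only []; abel
  have hinj0 : ∀ (x : B.adjoint.domain) (y : B.domain),
      P (x : H) + B y = 0 → B.adjoint x - Q (y : H) = 0 → x = 0 ∧ y = 0 := by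
    intro x y h1 h2
    have h3 : ⟪B.adjoint x, (y : H)⟫_ℂ = ⟪(x : H), B y⟫_ℂ :=
      LinearPMap.adjoint_isFormalAdjoint hBdense x y
    rw [sub_eq_zero.mp h2, eq_neg_of_add_eq_zero_right h1, inner_neg_right] at h3
    have h4 : (⟪(x : H), P x⟫_ℂ).re = (⟪P x, (x : H)⟫_ℂ).re := inner_re_symm (𝕜 := ℂ) _ _
    have h5 := congrArg Complex.re h3
    rw [Complex.neg_re, h4] at h5
    have h6 := hP x
    have h7 := hQ y
    have h8 : 0 ≤ (a - lam) * ‖(x : H)‖ ^ 2 := by positivity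
    have h9 : 0 ≤ (lam - d) * ‖(y : H)‖ ^ 2 := by positivity
    have h10 : (a - lam) * ‖(x : H)‖ ^ 2 = 0 := by linarith
    have h11 : (lam - d) * ‖(y : H)‖ ^ 2 = 0 := by linarith
    constructor
    · have := (mul_eq_zero.mp h10).resolve_left ha0.ne'
      exact Subtype.ext (norm_eq_zero.mp (pow_eq_zero_iff two_ne_zero |>.mp this))
    · have := (mul_eq_zero.mp h11).resolve_left hd0.ne'
      exact Subtype.ext (norm_eq_zero.mp (pow_eq_zero_iff two_ne_zero |>.mp this))
  constructor
  · rintro ⟨x, y⟩ ⟨x', y'⟩ h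
    simp only [hform, Prod.mk.injEq] at h
    obtain ⟨h1, h2⟩ := h
    obtain ⟨h3, h4⟩ := hinj0 (x - x') (y - y')
      (by
        rw [LinearPMap.map_sub, Submodule.coe_sub, map_sub]
        rw [← sub_eq_zero] at h1
        rw [← h1]; abel)
      (by
        rw [LinearPMap.map_sub, Submodule.coe_sub, map_sub]
        rw [← sub_eq_zero] at h2
        rw [← h2]; abel)
    rw [sub_eq_zero.mp h3, sub_eq_zero.mp h4]
  · rintro ⟨f, g⟩
    obtain ⟨x, y, h1, h2⟩ := aux_surj P Q B hBdense hBclosed _ _ ha0 hd0 hP hQ f g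
    exact ⟨(x, y), by simp only [hform, h1, h2]⟩
end

section
/- The block operator matrix 𝒯 with domain D(B*) ⊕ D(B) is selfadjoint: it is densely defined and coincides with its adjoint as an unbounded operator on H ⊕ H. -/
open WithLp in
theorem aux_graph {H : Type*} [NormedAddCommGroup H] [InnerProductSpace ℂ H] [CompleteSpace H]
    (B : H →ₗ.[ℂ] H) (hBdense : Dense (B.domain : Set H)) (hBclosed : B.IsClosed)
    (p q : H) (h : ∀ x : B.adjoint.domain, inner ℂ q (x : H) = inner ℂ p (B.adjoint x)) :
    (p, q) ∈ B.graph := by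
  let G : Submodule ℂ (WithLp 2 (H × H)) :=
    B.graph.comap (WithLp.linearEquiv 2 ℂ (H × H)).toLinearMap
  have hG : IsClosed (G : Set (WithLp 2 (H × H))) :=
    IsClosed.preimage (WithLp.prod_continuous_ofLp 2 H H) hBclosed
  have hmem : (toLp 2 (p, q)) ∈ G.orthogonal.orthogonal := by
    rw [Submodule.mem_orthogonal']
    intro u hu
    have hu1 : ∀ y : B.domain, inner ℂ u.fst (y : H) + inner ℂ u.snd (B y) = 0 := by
      intro y
      have := (Submodule.mem_orthogonal' _ _).1 hu (toLp 2 ((y : H), B y)) (B.mem_graph y)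
      simpa using this
    have hu2 : ∀ y : B.domain, inner ℂ (-u.fst) (y : H) = inner ℂ u.snd (B y) := by
      intro y
      rw [inner_neg_left]
      linear_combination -hu1 y
    have hd : u.snd ∈ B.adjoint.domain :=
      LinearPMap.mem_adjoint_domain_of_exists _ ⟨_, hu2⟩
    have he := LinearPMap.adjoint_apply_eq hBdense ⟨u.snd, hd⟩ hu2
    have := h ⟨u.snd, hd⟩
    rw [he, inner_neg_right] at this
    simp only [prod_inner_apply] at this ⊢
    change inner ℂ p u.fst + inner ℂ q u.snd = 0
    linear_combination this
  have hc : G.orthogonal.orthogonal = G := by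
    rw [Submodule.orthogonal_orthogonal_eq_closure, hG.submodule_topologicalClosure_eq]
  rw [hc] at hmem
  exact hmem

theorem aux_dense {H : Type*} [NormedAddCommGroup H] [InnerProductSpace ℂ H] [CompleteSpace H]
    (B : H →ₗ.[ℂ] H) (hBdense : Dense (B.domain : Set H)) (hBclosed : B.IsClosed) :
    Dense (B.adjoint.domain : Set H) := by
  rw [Submodule.dense_iff_topologicalClosure_eq_top, Submodule.topologicalClosure_eq_top_iff,
    Submodule.eq_bot_iff]
  intro q hq
  have := aux_graph B hBdense hBclosed 0 q (fun x => by
    rw [inner_zero_left]; exact (Submodule.mem_orthogonal' _ _).1 hq x x.2)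
  exact LinearPMap.graph_fst_eq_zero_snd B this rfl


theorem stmt6 {H : Type*} [NormedAddCommGroup H] [InnerProductSpace ℂ H] [CompleteSpace H]
    (A D : H →L[ℂ] H) (hA : IsSelfAdjoint A) (hD : IsSelfAdjoint D)
    (B : H →ₗ.[ℂ] H) (hBdense : Dense (B.domain : Set H)) (hBclosed : B.IsClosed)
    (a d : ℝ)
    (ha : a = sInf {r : ℝ | (r : ℂ) ∈ spectrum ℂ A})
    (hd : d = sSup {r : ℝ | (r : ℂ) ∈ spectrum ℂ D})
    (hda : d < a)
    (T : WithLp 2 (H × H) →ₗ.[ℂ] WithLp 2 (H × H))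
    (hdom : T.domain =
      (B.adjoint.domain.prod B.domain).comap (WithLp.linearEquiv 2 ℂ (H × H)).toLinearMap)
    (hact : ∀ (x : B.adjoint.domain) (y : B.domain)
        (h : (WithLp.linearEquiv 2 ℂ (H × H)).symm ((x : H), (y : H)) ∈ T.domain),
        T ⟨(WithLp.linearEquiv 2 ℂ (H × H)).symm ((x : H), (y : H)), h⟩
          = (WithLp.linearEquiv 2 ℂ (H × H)).symm
              (A (x : H) + B y, B.adjoint x + D (y : H))) :
    Dense (T.domain : Set (WithLp 2 (H × H))) ∧ T.adjoint = T := by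
  have hB' := aux_dense B hBdense hBclosed
  have hfa := LinearPMap.adjoint_isFormalAdjoint hBdense
  have hmem : ∀ x y : H, WithLp.toLp 2 (x, y) ∈ T.domain ↔ x ∈ B.adjoint.domain ∧ y ∈ B.domain := by
    intro x y
    rw [hdom]
    rfl
  have hT : ∀ (x : B.adjoint.domain) (y : B.domain)
      (h : WithLp.toLp 2 ((x : H), (y : H)) ∈ T.domain),
      T ⟨WithLp.toLp 2 ((x : H), (y : H)), h⟩
        = WithLp.toLp 2 (A (x : H) + B y, B.adjoint x + D (y : H)) := hact
  have hsA : ∀ x y : H, inner ℂ (A x) y = inner ℂ x (A y) :=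
    fun x y => (ContinuousLinearMap.isSelfAdjoint_iff_isSymmetric.1 hA) x y
  have hsD : ∀ x y : H, inner ℂ (D x) y = inner ℂ x (D y) :=
    fun x y => (ContinuousLinearMap.isSelfAdjoint_iff_isSymmetric.1 hD) x y
  have hdense : Dense (T.domain : Set (WithLp 2 (H × H))) := by
    have h1 : (T.domain : Set (WithLp 2 (H × H))) =
        (WithLp.homeomorphProd 2 H H) ⁻¹' ((B.adjoint.domain : Set H) ×ˢ (B.domain : Set H)) := by
      rw [hdom]
      rfl
    rw [h1]
    exact (hB'.prod hBdense).preimage (WithLp.homeomorphProd 2 H H).isOpenMap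
  refine ⟨hdense, ?_⟩
  have hsymm : T.IsFormalAdjoint T := by
    rintro ⟨u, hu⟩ ⟨v, hv⟩
    obtain ⟨u1, u2⟩ := u
    obtain ⟨v1, v2⟩ := v
    obtain ⟨hu1, hu2⟩ := (hmem _ _).1 hu
    obtain ⟨hv1, hv2⟩ := (hmem _ _).1 hv
    rw [hT ⟨u1, hu1⟩ ⟨u2, hu2⟩ hu, hT ⟨v1, hv1⟩ ⟨v2, hv2⟩ hv]
    simp only [WithLp.prod_inner_apply, inner_add_left, inner_add_right, hsA, hsD]
    have e1 := hfa ⟨u1, hu1⟩ ⟨v2, hv2⟩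
    have e2 := hfa.symm ⟨u2, hu2⟩ ⟨v1, hv1⟩
    simp only at e1 e2
    rw [e1, e2]
    ring
  have hle : T ≤ T.adjoint := hsymm.le_adjoint hdense
  refine (LinearPMap.eq_of_le_of_domain_eq hle (le_antisymm hle.1 ?_)).symm
  intro w hw
  have hfT := LinearPMap.adjoint_isFormalAdjoint hdense ⟨w, hw⟩
  generalize T.adjoint ⟨w, hw⟩ = z at hfT
  obtain ⟨w1, w2⟩ := w
  obtain ⟨z1, z2⟩ := z
  have key : ∀ (x : B.adjoint.domain) (y : B.domain),
      inner ℂ z1 (x : H) + inner ℂ z2 (y : H) =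
        inner ℂ w1 (A x + B y) + inner ℂ w2 (B.adjoint x + D y) := by
    intro x y
    have hxy := (hmem x y).2 ⟨x.2, y.2⟩
    have := hfT ⟨_, hxy⟩
    rw [hT x y hxy] at this
    simpa only [WithLp.prod_inner_apply] using this
  rw [hmem]
  constructor
  · refine LinearPMap.mem_adjoint_domain_of_exists _ ⟨z2 - D w2, fun y => ?_⟩
    have := key 0 y
    simp only [inner_add_right, LinearPMap.map_zero, ZeroMemClass.coe_zero, map_zero,
      inner_zero_right, zero_add] at this
    rw [inner_sub_left, hsD]
    linear_combination this
  · have hg : (w2, z1 - A w1) ∈ B.graph := by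
      refine aux_graph B hBdense hBclosed _ _ fun x => ?_
      have := key x 0
      simp only [inner_add_right, LinearPMap.map_zero, ZeroMemClass.coe_zero, map_zero,
        inner_zero_right, add_zero] at this
      rw [inner_sub_left, hsA]
      linear_combination this
    exact LinearPMap.mem_domain_of_mem_graph hg
end

section
/- Let λ be real with λ > d. A pair (x, y) ∈ D(B*) ⊕ D(B) satisfies 𝒯(x, y) = λ(x, y) if and only if y = −(D − λ)⁻¹B*x, (D − λ)⁻¹B*x ∈ D(B), and (A − λ)x − B((D − λ)⁻¹B*x) = 0. Consequently, the map (x, y) ↦ x is a linear bijection from ker(𝒯 − λ) onto ker S(λ), where S(λ) = A − λ − B(D − λ)⁻¹B* has domain {x ∈ D(B*) : (D − λ)⁻¹B*x ∈ D(B)}; in particular λ is an eigenvalue of 𝒯 if and only if 0 is an eigenvalue of S(λ). -/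
/-- The resolvent `(D − λ)⁻¹` of a bounded operator. -/
noncomputable def resolventD {H : Type*} [NormedAddCommGroup H] [InnerProductSpace ℂ H]
    (D : H →L[ℂ] H) (lam : ℂ) : H →L[ℂ] H :=
  Ring.inverse (D - lam • (1 : H →L[ℂ] H))

theorem stmt7 {H : Type*} [NormedAddCommGroup H] [InnerProductSpace ℂ H] [CompleteSpace H]
    (A D : H →L[ℂ] H) (hA : IsSelfAdjoint A) (hD : IsSelfAdjoint D)
    (B : H →ₗ.[ℂ] H) (hBdense : Dense (B.domain : Set H)) (hBclosed : B.IsClosed)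
    (a d : ℝ)
    (ha : a = sInf {r : ℝ | (r : ℂ) ∈ spectrum ℂ A})
    (hd : d = sSup {r : ℝ | (r : ℂ) ∈ spectrum ℂ D})
    (hda : d < a)
    (lam : ℝ) (hlam : d < lam) :
    (∀ (x : B.adjoint.domain) (y : B.domain),
      (A (x : H) + B y = (lam : ℂ) • (x : H)
          ∧ B.adjoint x + D (y : H) = (lam : ℂ) • (y : H))
        ↔ ∃ h : resolventD D (lam : ℂ) (B.adjoint x) ∈ B.domain,
            (y : H) = -(resolventD D (lam : ℂ) (B.adjoint x))
            ∧ A (x : H) - (lam : ℂ) • (x : H)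
                - B ⟨resolventD D (lam : ℂ) (B.adjoint x), h⟩ = 0)
    ∧ Set.BijOn (fun p : B.adjoint.domain × B.domain => p.1)
        {p : B.adjoint.domain × B.domain |
          A (p.1 : H) + B p.2 = (lam : ℂ) • (p.1 : H)
          ∧ B.adjoint p.1 + D (p.2 : H) = (lam : ℂ) • (p.2 : H)}
        {x : B.adjoint.domain | ∃ h : resolventD D (lam : ℂ) (B.adjoint x) ∈ B.domain,
          A (x : H) - (lam : ℂ) • (x : H)
            - B ⟨resolventD D (lam : ℂ) (B.adjoint x), h⟩ = 0}
    ∧ ((∃ p : B.adjoint.domain × B.domain, p ≠ 0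
          ∧ A (p.1 : H) + B p.2 = (lam : ℂ) • (p.1 : H)
          ∧ B.adjoint p.1 + D (p.2 : H) = (lam : ℂ) • (p.2 : H))
        ↔ (∃ x : B.adjoint.domain, x ≠ 0
          ∧ ∃ h : resolventD D (lam : ℂ) (B.adjoint x) ∈ B.domain,
            A (x : H) - (lam : ℂ) • (x : H)
              - B ⟨resolventD D (lam : ℂ) (B.adjoint x), h⟩ = 0)) := by
  have hunit : IsUnit (D - (lam : ℂ) • (1 : H →L[ℂ] H)) := by
    by_contra hn
    have hmem : (lam : ℂ) ∈ spectrum ℂ D := by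
      rw [spectrum.mem_iff, Algebra.algebraMap_eq_smul_one]
      intro h
      apply hn
      have h2 := h.neg
      rwa [neg_sub] at h2
    have hbdd : BddAbove {r : ℝ | (r : ℂ) ∈ spectrum ℂ D} := by
      obtain ⟨C, hC⟩ := (spectrum.isBounded D (𝕜 := ℂ)).exists_norm_le
      refine ⟨C, fun r hr => ?_⟩
      have h1 := hC _ hr
      rw [Complex.norm_real] at h1
      exact (le_abs_self r).trans h1
    have hle := le_csSup hbdd (show lam ∈ {r : ℝ | (r : ℂ) ∈ spectrum ℂ D} from hmem)
    rw [← hd] at hle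
    linarith
  have hRl : ∀ v : H, resolventD D (lam : ℂ) (D v - (lam : ℂ) • v) = v := by
    intro v
    have h := congrArg (fun T : H →L[ℂ] H => T v) (Ring.inverse_mul_cancel _ hunit)
    simpa [resolventD] using h
  have hRr : ∀ v : H, D (resolventD D (lam : ℂ) v) - (lam : ℂ) • resolventD D (lam : ℂ) v = v := by
    intro v
    have h := congrArg (fun T : H →L[ℂ] H => T v) (Ring.mul_inverse_cancel _ hunit)
    simpa [resolventD] using h
  have key : ∀ (x : B.adjoint.domain) (y : B.domain),
      (A (x : H) + B y = (lam : ℂ) • (x : H)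
          ∧ B.adjoint x + D (y : H) = (lam : ℂ) • (y : H))
        ↔ ∃ h : resolventD D (lam : ℂ) (B.adjoint x) ∈ B.domain,
            (y : H) = -(resolventD D (lam : ℂ) (B.adjoint x))
            ∧ A (x : H) - (lam : ℂ) • (x : H)
                - B ⟨resolventD D (lam : ℂ) (B.adjoint x), h⟩ = 0 := by
    intro x y
    constructor
    · rintro ⟨h1, h2⟩
      have h3 : B.adjoint x = -(D (y : H) - (lam : ℂ) • (y : H)) := by
        rw [← h2]; abel
      have h4 : resolventD D (lam : ℂ) (B.adjoint x) = -(y : H) := by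
        rw [h3, map_neg, hRl]
      have h5 : resolventD D (lam : ℂ) (B.adjoint x) ∈ B.domain := by
        rw [h4]; exact B.domain.neg_mem y.2
      refine ⟨h5, by rw [h4, neg_neg], ?_⟩
      have h6 : (⟨resolventD D (lam : ℂ) (B.adjoint x), h5⟩ : B.domain) = -y :=
        Subtype.ext h4
      rw [h6, B.map_neg, ← h1]; abel
    · rintro ⟨h, hy, h1⟩
      have h6 : (⟨resolventD D (lam : ℂ) (B.adjoint x), h⟩ : B.domain) = -y :=
        Subtype.ext (by simp [hy])
      rw [h6, B.map_neg] at h1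
      constructor
      · rw [← sub_eq_zero, ← h1]; abel
      · have h7 := hRr (B.adjoint x)
        rw [hy, map_neg, smul_neg]
        nth_rewrite 1 [← h7]
        abel
  refine ⟨key, ⟨?_, ?_, ?_⟩, ?_⟩
  · rintro ⟨x, y⟩ hp
    obtain ⟨h, -, h1⟩ := (key x y).1 hp
    exact ⟨h, h1⟩
  · rintro ⟨x, y⟩ hp ⟨x', y'⟩ hp' hxx
    obtain rfl : x = x' := hxx
    obtain ⟨_, h1, -⟩ := (key x y).1 hp
    obtain ⟨_, h2, -⟩ := (key x y').1 hp'
    exact Prod.ext rfl (Subtype.ext (h1.trans h2.symm))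
  · rintro x ⟨h, h1⟩
    exact ⟨(x, ⟨_, B.domain.neg_mem h⟩), (key x ⟨_, B.domain.neg_mem h⟩).2 ⟨h, rfl, h1⟩, rfl⟩
  · constructor
    · rintro ⟨⟨x, y⟩, hne, hp⟩
      obtain ⟨h, hy, h1⟩ := (key x y).1 hp
      refine ⟨x, ?_, h, h1⟩
      rintro rfl
      apply hne
      have h0 : B.adjoint (0 : B.adjoint.domain) = 0 := B.adjoint.map_zero
      rw [h0, map_zero, neg_zero] at hy
      exact Prod.ext rfl (Subtype.ext hy)
    · rintro ⟨x, hx, h, h1⟩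
      exact ⟨(x, ⟨_, B.domain.neg_mem h⟩), fun h0 => hx (congrArg Prod.fst h0),
        (key x ⟨_, B.domain.neg_mem h⟩).2 ⟨h, rfl, h1⟩⟩
end

section
/- Let λ > −m₂ be real. Then, as n → ∞, ∫_ℝ W(x)φ_n(x)φ_n'(x)/(M₂(x) + λ) dx → (1/2)·(W₋/(M₂₋ + λ) − W₊/(M₂₊ + λ)), and ∫_ℝ φ_n'(x)²/(M₂(x) + λ) dx → 0, where φ_n' denotes the (almost everywhere defined) derivative of φ_n. -/
open MeasureTheory

/-- The tent function `φ_n`. -/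
noncomputable def tent (n : ℕ) (x : ℝ) : ℝ :=
  if |x| ≤ (n : ℝ) then 1
  else if |x| < 2 * (n : ℝ) then (2 * (n : ℝ) - |x|) / (n : ℝ)
  else 0

/-- The (almost everywhere defined) derivative of the tent function `φ_n`. -/
noncomputable def tentDeriv (n : ℕ) (x : ℝ) : ℝ :=
  if (n : ℝ) < |x| ∧ |x| < 2 * (n : ℝ) then -Real.sign x / (n : ℝ) else 0

/-- Rescaled first integrand, in explicit form. -/
lemma scaled_first (n : ℕ) (hn : 1 ≤ n) (y : ℝ) :
    (n : ℝ) * (tent n (n * y) * tentDeriv n (n * y)) =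
      Set.indicator (Set.Ioo 1 2) (fun y => y - 2) y
        + Set.indicator (Set.Ioo (-2) (-1)) (fun y => 2 + y) y := by
  have hn0 : (0 : ℝ) < n := by exact_mod_cast hn
  have h1 : (n : ℝ) < |(n : ℝ) * y| ↔ 1 < |y| := by
    rw [abs_mul, abs_of_pos hn0]
    constructor <;> intro h <;> nlinarith
  have h1' : |(n : ℝ) * y| ≤ (n : ℝ) ↔ |y| ≤ 1 := by
    rw [← not_lt, h1, not_lt]
  have h2 : |(n : ℝ) * y| < 2 * (n : ℝ) ↔ |y| < 2 := by
    rw [abs_mul, abs_of_pos hn0]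
    constructor <;> intro h <;> nlinarith
  unfold tent tentDeriv
  simp only [h1, h1', h2]
  by_cases hA : 1 < |y| ∧ |y| < 2
  · rw [if_neg (not_le.mpr hA.1), if_pos hA.2, if_pos hA]
    obtain ⟨ha, hb⟩ := hA
    rcases lt_or_ge y 0 with hy | hy
    · rw [abs_of_neg hy] at ha hb
      rw [Real.sign_of_neg (mul_neg_of_pos_of_neg hn0 hy),
        abs_of_neg (mul_neg_of_pos_of_neg hn0 hy),
        Set.indicator_of_notMem (by simp only [Set.mem_Ioo]; intro h; linarith [h.1]),
        Set.indicator_of_mem (by constructor <;> linarith)]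
      field_simp
      ring
    · rw [abs_of_nonneg hy] at ha hb
      have hy' : 0 < y := by linarith
      rw [Real.sign_of_pos (mul_pos hn0 hy'),
        abs_of_pos (mul_pos hn0 hy'),
        Set.indicator_of_mem (by constructor <;> linarith),
        Set.indicator_of_notMem (by simp only [Set.mem_Ioo]; intro h; linarith [h.2])]
      field_simp
      ring
  · rw [if_neg hA, Set.indicator_of_notMem, Set.indicator_of_notMem]
    · simp
    · rintro ⟨h, h'⟩
      exact hA (by rw [abs_of_neg (by linarith)]; constructor <;> linarith)
    · rintro ⟨h, h'⟩
      exact hA (by rw [abs_of_pos (by linarith)]; constructor <;> linarith)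

lemma tentDeriv_sq_le (n : ℕ) (x : ℝ) :
    (tentDeriv n x) ^ 2 ≤ Set.indicator (Set.Icc (-(2 * (n : ℝ))) (2 * n)) (fun _ => 1 / (n : ℝ) ^ 2) x := by
  unfold tentDeriv
  split_ifs with h
  · rw [Set.indicator_of_mem (by have := abs_lt.mp h.2; constructor <;> linarith), div_pow, neg_sq]
    gcongr
    rcases Real.sign_apply_eq x with h | h | h <;> rw [h] <;> norm_num
  · apply le_trans (by norm_num) (Set.indicator_nonneg _ x)
    intros; positivity

lemma first_limit (G : ℝ → ℝ) (hG : Measurable G) (K : ℝ) (hK : ∀ x, |G x| ≤ K) (a b : ℝ)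
    (ha : Filter.Tendsto G Filter.atTop (nhds a)) (hb : Filter.Tendsto G Filter.atBot (nhds b)) :
    Filter.Tendsto (fun n : ℕ => ∫ x : ℝ, G x * (tent n x * tentDeriv n x))
      Filter.atTop (nhds ((1 / 2) * (b - a))) := by
  set p : ℝ → ℝ := Set.indicator (Set.Ioo 1 2) (fun y => y - 2) with hp
  set q : ℝ → ℝ := Set.indicator (Set.Ioo (-2) (-1)) (fun y => 2 + y) with hq
  have hpi : Integrable p := by
    rw [hp, integrable_indicator_iff measurableSet_Ioo]
    exact (Continuous.integrableOn_Icc (by fun_prop)).mono_set Set.Ioo_subset_Icc_self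
  have hqi : Integrable q := by
    rw [hq, integrable_indicator_iff measurableSet_Ioo]
    exact (Continuous.integrableOn_Icc (by fun_prop)).mono_set Set.Ioo_subset_Icc_self
  have hpI : ∫ y, p y = -(1 / 2) := by
    rw [hp, integral_indicator measurableSet_Ioo, ← integral_Ioc_eq_integral_Ioo,
      ← intervalIntegral.integral_of_le (by norm_num), intervalIntegral.integral_sub (by simp) (by simp)]
    simp; norm_num
  have hqI : ∫ y, q y = 1 / 2 := by
    rw [hq, integral_indicator measurableSet_Ioo, ← integral_Ioc_eq_integral_Ioo,
      ← intervalIntegral.integral_of_le (by norm_num), intervalIntegral.integral_add (by simp) (by simp)]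
    simp; norm_num
  have hlim : (1 / 2) * (b - a) = ∫ y, (a * p y + b * q y) := by
    rw [integral_add (hpi.const_mul a) (hqi.const_mul b), integral_const_mul, integral_const_mul,
      hpI, hqI]
    ring
  rw [hlim]
  have key : Filter.Tendsto (fun n : ℕ => ∫ y : ℝ, G (n * y) * (p y + q y)) Filter.atTop
      (nhds (∫ y, (a * p y + b * q y))) := by
    apply tendsto_integral_of_dominated_convergence (fun y => K * |p y + q y|)
    · intro n
      exact ((hG.comp (measurable_const_mul _)).aestronglyMeasurable).mul
        (hpi.add hqi).aestronglyMeasurable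
    · exact (hpi.add hqi).abs.const_mul K
    · intro n
      refine Filter.Eventually.of_forall fun y => ?_
      rw [Real.norm_eq_abs, abs_mul]
      exact mul_le_mul_of_nonneg_right (hK _) (abs_nonneg _)
    · refine Filter.Eventually.of_forall fun y => ?_
      rcases lt_trichotomy y 0 with hy | hy | hy
      · have : p y = 0 := Set.indicator_of_notMem (fun h => by linarith [h.1]) _
        simp only [this, mul_zero, zero_add]
        exact (hb.comp (tendsto_natCast_atTop_atTop.atTop_mul_const_of_neg hy)).mul_const _
      · have h1 : p y = 0 := Set.indicator_of_notMem (fun h => by linarith [h.1]) _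
        have h2 : q y = 0 := Set.indicator_of_notMem (fun h => by linarith [h.2]) _
        simp [h1, h2]
      · have : q y = 0 := Set.indicator_of_notMem (fun h => by linarith [h.2]) _
        simp only [this, mul_zero, add_zero]
        exact (ha.comp (tendsto_natCast_atTop_atTop.atTop_mul_const hy)).mul_const _
  refine key.congr' ?_
  filter_upwards [Filter.eventually_ge_atTop 1] with n hn
  have hn0 : (0 : ℝ) < n := by exact_mod_cast hn
  have h := Measure.integral_comp_mul_left (fun x => G x * (tent n x * tentDeriv n x)) (n : ℝ)
  have h3 : ∀ y, G (n * y) * (p y + q y)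
      = n * (G (n * y) * (tent n (n * y) * tentDeriv n (n * y))) := by
    intro y
    rw [hp, hq, ← scaled_first n hn y]
    ring
  simp only [h3]
  rw [integral_const_mul, h, abs_of_pos (by positivity), smul_eq_mul]
  field_simp

lemma second_limit (G : ℝ → ℝ) (K : ℝ) (hK : ∀ x, |G x| ≤ K) :
    Filter.Tendsto (fun n : ℕ => ∫ x : ℝ, (tentDeriv n x) ^ 2 * G x)
      Filter.atTop (nhds 0) := by
  have hK0 : 0 ≤ K := (abs_nonneg _).trans (hK 0)
  have hz : Filter.Tendsto (fun n : ℕ => (4 * K) / (n : ℝ)) Filter.atTop (nhds 0) :=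
    tendsto_const_div_atTop_nhds_zero_nat _
  apply squeeze_zero_norm' _ hz
  filter_upwards [Filter.eventually_ge_atTop 1] with n hn
  have hn0 : (0 : ℝ) < n := by exact_mod_cast hn
  have hi : Integrable (Set.indicator (Set.Icc (-(2 * (n : ℝ))) (2 * n))
      (fun _ => 1 / (n : ℝ) ^ 2)) := by
    rw [integrable_indicator_iff measurableSet_Icc]
    exact Continuous.integrableOn_Icc (by fun_prop)
  refine (norm_integral_le_of_norm_le (hi.mul_const K) (Filter.Eventually.of_forall fun x => ?_)).trans ?_
  · rw [Real.norm_eq_abs, abs_mul, abs_of_nonneg (sq_nonneg _)]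
    exact mul_le_mul (tentDeriv_sq_le n x) (hK x) (abs_nonneg _)
      ((sq_nonneg _).trans (tentDeriv_sq_le n x))
  · rw [integral_mul_const, integral_indicator measurableSet_Icc, setIntegral_const,
      Measure.real, Real.volume_Icc, ENNReal.toReal_ofReal (by linarith), smul_eq_mul]
    apply le_of_eq
    field_simp
    ring

theorem stmt11
    (M₁ M₂ W : ℝ → ℝ)
    (hM₁meas : Measurable M₁) (hM₂meas : Measurable M₂) (hWmeas : Measurable W)
    (hM₁bdd : ∃ C, ∀ x, |M₁ x| ≤ C) (hM₂bdd : ∃ C, ∀ x, |M₂ x| ≤ C)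
    (hWbdd : ∃ C, ∀ x, |W x| ≤ C)
    (Wp Wn M1p M1n M2p M2n : ℝ)
    (hWp : Filter.Tendsto W Filter.atTop (nhds Wp))
    (hWn : Filter.Tendsto W Filter.atBot (nhds Wn))
    (hM1p : Filter.Tendsto M₁ Filter.atTop (nhds M1p))
    (hM1n : Filter.Tendsto M₁ Filter.atBot (nhds M1n))
    (hM2p : Filter.Tendsto M₂ Filter.atTop (nhds M2p))
    (hM2n : Filter.Tendsto M₂ Filter.atBot (nhds M2n))
    (m₁ m₂ : ℝ) (hm₁ : m₁ = sInf (Set.range M₁)) (hm₂ : m₂ = sInf (Set.range M₂))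
    (hgap : -m₂ < m₁)
    (lam : ℝ) (hlam : -m₂ < lam) :
    Filter.Tendsto (fun n : ℕ => ∫ x : ℝ, W x * tent n x * tentDeriv n x / (M₂ x + lam))
      Filter.atTop (nhds ((1 / 2) * (Wn / (M2n + lam) - Wp / (M2p + lam))))
    ∧ Filter.Tendsto (fun n : ℕ => ∫ x : ℝ, (tentDeriv n x) ^ 2 / (M₂ x + lam))
      Filter.atTop (nhds 0) := by
  obtain ⟨C, hC⟩ := hM₂bdd
  obtain ⟨D, hD⟩ := hWbdd
  have hD0 : 0 ≤ D := (abs_nonneg _).trans (hD 0)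
  have hbb : BddBelow (Set.range M₂) := by
    refine ⟨-C, ?_⟩
    rintro _ ⟨x, rfl⟩
    exact (abs_le.mp (hC x)).1
  have hm : ∀ x, m₂ ≤ M₂ x := fun x => hm₂ ▸ csInf_le hbb ⟨x, rfl⟩
  have hd : 0 < m₂ + lam := by linarith
  have hpos : ∀ x, m₂ + lam ≤ M₂ x + lam := fun x => by linarith [hm x]
  have hp : M2p + lam ≠ 0 := by
    have := ge_of_tendsto' hM2p hm
    linarith
  have hn : M2n + lam ≠ 0 := by
    have := ge_of_tendsto' hM2n hm
    linarith
  have hinv : ∀ x, |(M₂ x + lam)⁻¹| ≤ (m₂ + lam)⁻¹ := fun x => by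
    rw [abs_of_nonneg (inv_nonneg.mpr (hd.le.trans (hpos x)))]
    exact inv_anti₀ hd (hpos x)
  constructor
  · have := first_limit (fun x => W x / (M₂ x + lam)) (hWmeas.div (hM₂meas.add_const lam))
      (D * (m₂ + lam)⁻¹) (fun x => by
        rw [div_eq_mul_inv, abs_mul]
        exact mul_le_mul (hD x) (hinv x) (abs_nonneg _) hD0) _ _
      (hWp.div (hM2p.add_const lam) hp) (hWn.div (hM2n.add_const lam) hn)
    refine this.congr fun n => ?_
    congr 1
    funext x
    ring
  · simpa only [div_eq_mul_inv] using second_limit (fun x => (M₂ x + lam)⁻¹) _ hinv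
end

section
/- Let λ > −m₂ be real and define F : ℝ → ℝ by F(x) := ((M₁(x) − λ)(M₂(x) + λ) + W(x)²)/(M₂(x) + λ). If F is integrable on ℝ, then, as n → ∞, ∫_ℝ [(M₁(x) − λ)φ_n(x)² + (−φ_n'(x) + W(x)φ_n(x))²/(M₂(x) + λ)] dx → ∫_ℝ F(x) dx − (W₋/(M₂₋ + λ) − W₊/(M₂₊ + λ)). -/
open MeasureTheory

theorem aux_tent_meas (n : ℕ) : Measurable (tent n) := by
  unfold tent
  refine Measurable.ite (measurableSet_le (by fun_prop) (by fun_prop)) (by fun_prop) ?_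
  exact Measurable.ite (measurableSet_lt (by fun_prop) (by fun_prop)) (by fun_prop) (by fun_prop)

theorem aux_sign_meas : Measurable Real.sign := by
  have : Real.sign = fun r : ℝ => if r < 0 then (-1 : ℝ) else if 0 < r then 1 else 0 := by
    funext r; rfl
  rw [this]
  refine Measurable.ite (measurableSet_lt (by fun_prop) (by fun_prop)) (by fun_prop) ?_
  exact Measurable.ite (measurableSet_lt (by fun_prop) (by fun_prop)) (by fun_prop) (by fun_prop)

theorem aux_tentDeriv_meas (n : ℕ) : Measurable (tentDeriv n) := by
  unfold tentDeriv
  have h := aux_sign_meas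
  refine Measurable.ite ?_ (by fun_prop) (by fun_prop)
  have e1 : MeasurableSet {x : ℝ | (n : ℝ) < |x|} := measurableSet_lt (by fun_prop) (by fun_prop)
  have e2 : MeasurableSet {x : ℝ | |x| < 2 * (n : ℝ)} :=
    measurableSet_lt (by fun_prop) (by fun_prop)
  exact e1.inter e2

theorem aux_tent_abs (n : ℕ) (x : ℝ) : |tent n x| ≤ 1 := by
  unfold tent
  split_ifs with h1 h2
  · simp
  · push Not at h1
    have hn : (0 : ℝ) < n := by
      rcases (Nat.cast_nonneg n : (0 : ℝ) ≤ n).lt_or_eq with h | h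
      · exact h
      · rw [← h] at h1 h2; linarith
    rw [abs_of_nonneg (div_nonneg (by linarith) hn.le), div_le_one hn]
    linarith
  · simp

theorem aux_scale {n : ℕ} (hn : 0 < n) (t : ℝ) (h1 : 1 < |t|) (h2 : |t| < 2) :
    tent n (n * t) = 2 - |t| ∧ tentDeriv n (n * t) = - Real.sign t / n := by
  have hn' : (0 : ℝ) < n := by exact_mod_cast hn
  have e : |(n : ℝ) * t| = n * |t| := by rw [abs_mul, abs_of_pos hn']
  have s : Real.sign ((n : ℝ) * t) = Real.sign t := by
    rcases lt_trichotomy t 0 with h | h | h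
    · rw [Real.sign_of_neg h, Real.sign_of_neg (mul_neg_of_pos_of_neg hn' h)]
    · simp [h]
    · rw [Real.sign_of_pos h, Real.sign_of_pos (mul_pos hn' h)]
  have a1 : (n : ℝ) < n * |t| := by nlinarith
  have a2 : (n : ℝ) * |t| < 2 * n := by nlinarith
  constructor
  · unfold tent
    rw [e, if_neg (not_le.mpr a1), if_pos a2]
    field_simp
  · unfold tentDeriv
    rw [e, s, if_pos ⟨a1, a2⟩]

theorem aux_scale0 {n : ℕ} (hn : 0 < n) (t : ℝ) (h : ¬ (1 < |t| ∧ |t| < 2)) :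
    tentDeriv n (n * t) = 0 := by
  have hn' : (0 : ℝ) < n := by exact_mod_cast hn
  have e : |(n : ℝ) * t| = n * |t| := by rw [abs_mul, abs_of_pos hn']
  unfold tentDeriv
  rw [e, if_neg]
  rintro ⟨a, b⟩
  exact h ⟨by nlinarith, by nlinarith⟩

/-- the limit profile -/
noncomputable def auxL (a b : ℝ) (t : ℝ) : ℝ :=
  (Set.Ioc (1 : ℝ) 2).indicator (fun t => 2 * (2 - t) * a) t
   + (Set.Ioc (-2 : ℝ) (-1)).indicator (fun t => -2 * (2 + t) * b) t

theorem auxL_int (a b : ℝ) : ∫ t, auxL a b t = a - b := by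
  unfold auxL
  have i1 : Integrable ((Set.Ioc (1 : ℝ) 2).indicator (fun t : ℝ => 2 * (2 - t) * a)) := by
    rw [integrable_indicator_iff measurableSet_Ioc]
    exact (Continuous.integrableOn_Icc (by fun_prop)).mono_set Set.Ioc_subset_Icc_self
  have i2 : Integrable ((Set.Ioc (-2 : ℝ) (-1)).indicator (fun t : ℝ => -2 * (2 + t) * b)) := by
    rw [integrable_indicator_iff measurableSet_Ioc]
    exact (Continuous.integrableOn_Icc (by fun_prop)).mono_set Set.Ioc_subset_Icc_self
  rw [integral_add i1 i2, integral_indicator measurableSet_Ioc, integral_indicator measurableSet_Ioc,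
    ← intervalIntegral.integral_of_le (by norm_num), ← intervalIntegral.integral_of_le (by norm_num)]
  have d1 : ∫ t in (1 : ℝ)..2, 2 * (2 - t) * a = a := by
    rw [intervalIntegral.integral_eq_sub_of_hasDerivAt (f := fun t => (4 * t - t ^ 2) * a)]
    · ring
    · intro x _
      have := ((((hasDerivAt_id x).const_mul 4).sub ((hasDerivAt_id x).pow 2)).mul_const a)
      refine this.congr_deriv ?_
      simp only [id, Nat.cast_ofNat]; ring
    · exact Continuous.intervalIntegrable (by fun_prop) _ _
  have d2 : ∫ t in (-2 : ℝ)..(-1), -2 * (2 + t) * b = -b := by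
    rw [intervalIntegral.integral_eq_sub_of_hasDerivAt (f := fun t => (-4 * t - t ^ 2) * b)]
    · ring
    · intro x _
      have := ((((hasDerivAt_id x).const_mul (-4)).sub ((hasDerivAt_id x).pow 2)).mul_const b)
      refine this.congr_deriv ?_
      simp only [id, Nat.cast_ofNat]; ring
    · exact Continuous.intervalIntegrable (by fun_prop) _ _
  rw [d1, d2]; ring

theorem aux_B (W d : ℝ → ℝ) (hW : Measurable W) (hd : Measurable d) (CW c : ℝ) (hc : 0 < c)
    (hCW : ∀ x, |W x| ≤ CW) (hdc : ∀ x, c ≤ d x) (Wp Wn dp dn : ℝ)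
    (hWp : Filter.Tendsto W Filter.atTop (nhds Wp))
    (hWn : Filter.Tendsto W Filter.atBot (nhds Wn))
    (hdp : Filter.Tendsto d Filter.atTop (nhds dp))
    (hdn : Filter.Tendsto d Filter.atBot (nhds dn))
    (B : ℕ → ℝ → ℝ)
    (hB : ∀ n x, B n x = (tentDeriv n x ^ 2 - 2 * tentDeriv n x * tent n x * W x) / d x) :
    (∀ n, 0 < n → Integrable (B n)) ∧
    Filter.Tendsto (fun n => ∫ x, B n x) Filter.atTop (nhds (Wp / dp - Wn / dn)) := by
  have hdp0 : dp ≠ 0 := (lt_of_lt_of_le hc (ge_of_tendsto' hdp hdc)).ne'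
  have hdn0 : dn ≠ 0 := (lt_of_lt_of_le hc (ge_of_tendsto' hdn hdc)).ne'
  have hBm : ∀ n, Measurable (B n) := by
    intro n
    have := aux_tent_meas n
    have := aux_tentDeriv_meas n
    rw [funext (hB n)]
    fun_prop
  have hCW0 : 0 ≤ CW := (abs_nonneg _).trans (hCW 0)
  -- formula
  have form : ∀ n : ℕ, 0 < n → ∀ t : ℝ, 1 < |t| → |t| < 2 →
      n * B n (n * t) = (Real.sign t ^ 2 * (n : ℝ)⁻¹ + 2 * Real.sign t * (2 - |t|) * W (n * t)) / d (n * t) := by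
    intro n hn t h1 h2
    have hn' : (n : ℝ) ≠ 0 := by exact_mod_cast hn.ne'
    obtain ⟨e1, e2⟩ := aux_scale hn t h1 h2
    have := (lt_of_lt_of_le hc (hdc (n * t))).ne'
    rw [hB, e1, e2]
    field_simp
    ring
  have form0 : ∀ n : ℕ, 0 < n → ∀ t : ℝ, ¬ (1 < |t| ∧ |t| < 2) → n * B n (n * t) = 0 := by
    intro n hn t h
    rw [hB, aux_scale0 hn t h]
    simp
  have bint : Integrable ((Set.Icc (-2 : ℝ) 2).indicator (fun _ => (1 + 2 * CW) / c)) := by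
    rw [integrable_indicator_iff measurableSet_Icc]
    exact Continuous.integrableOn_Icc (by fun_prop)
  have bd : ∀ n : ℕ, 0 < n → ∀ t : ℝ,
      ‖n * B n (n * t)‖ ≤ (Set.Icc (-2 : ℝ) 2).indicator (fun _ => (1 + 2 * CW) / c) t := by
    intro n hn t
    by_cases h : 1 < |t| ∧ |t| < 2
    · rw [form n hn t h.1 h.2, Set.indicator_of_mem
        (Set.mem_Icc.mpr ⟨by linarith [neg_abs_le t], by linarith [le_abs_self t]⟩)]
      have hs : |Real.sign t| ≤ 1 := by
        rcases Real.sign_apply_eq t with h | h | h <;> simp [h]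
      have hn1 : (n : ℝ)⁻¹ ≤ 1 := inv_le_one_of_one_le₀ (by exact_mod_cast hn)
      have hn0 : 0 ≤ (n : ℝ)⁻¹ := by positivity
      have hdd := hdc (n * t)
      rw [Real.norm_eq_abs, abs_div, abs_of_pos (lt_of_lt_of_le hc hdd)]
      apply div_le_div₀ (by positivity) _ hc hdd
      refine (abs_add_le _ _).trans (add_le_add ?_ ?_)
      · rw [abs_mul, abs_pow, abs_of_nonneg hn0]
        exact mul_le_one₀ (pow_le_one₀ (abs_nonneg _) hs) hn0 hn1
      · rw [abs_mul, abs_mul, abs_mul, abs_two]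
        have : |2 - (|t|)| ≤ 1 := by rw [abs_le]; constructor <;> linarith [h.1, h.2]
        have h3 : |Real.sign t| * |2 - (|t|)| ≤ 1 := mul_le_one₀ hs (abs_nonneg _) this
        have h4 := mul_le_mul h3 (hCW (n * t)) (abs_nonneg _) zero_le_one
        nlinarith
    · rw [form0 n hn t h, norm_zero]
      apply Set.indicator_nonneg
      intro _ _; positivity
  have hm : ∀ n : ℕ, Measurable (fun t : ℝ => (n : ℝ) * B n (n * t)) := by
    intro n
    have := hBm n
    fun_prop
  have change : ∀ n : ℕ, 0 < n → ∫ t, (n : ℝ) * B n (n * t) = ∫ x, B n x := by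
    intro n hn
    have hn' : (0 : ℝ) < n := by exact_mod_cast hn
    rw [integral_const_mul, Measure.integral_comp_mul_left, smul_eq_mul,
      abs_of_pos (inv_pos.mpr hn'), ← mul_assoc, mul_inv_cancel₀ hn'.ne', one_mul]
  refine ⟨?_, ?_⟩
  · intro n hn
    have hn' : (n : ℝ) ≠ 0 := by exact_mod_cast hn.ne'
    have h1 : Integrable (fun t : ℝ => (n : ℝ) * B n (n * t)) :=
      bint.mono' (hm n).aestronglyMeasurable (Filter.Eventually.of_forall (bd n hn))
    have h2 := h1.const_mul ((n : ℝ)⁻¹)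
    have h3 : Integrable (fun t : ℝ => B n (n * t)) := by
      refine h2.congr (Filter.Eventually.of_forall fun t => ?_)
      simp only
      rw [← mul_assoc, inv_mul_cancel₀ hn', one_mul]
    exact (integrable_comp_mul_left_iff (B n) hn').mp h3
  · rw [← auxL_int]
    have key : Filter.Tendsto (fun n : ℕ => ∫ t, (n : ℝ) * B n (n * t)) Filter.atTop
        (nhds (∫ t, auxL (Wp / dp) (Wn / dn) t)) := by
      refine tendsto_integral_filter_of_dominated_convergence _
        (Filter.Eventually.of_forall fun n => (hm n).aestronglyMeasurable)
        ?_ bint ?_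
      · filter_upwards [Filter.eventually_gt_atTop 0] with n hn
        exact Filter.Eventually.of_forall (bd n hn)
      · have hne : ∀ᵐ t : ℝ, t ≠ 2 ∧ t ≠ -1 := by
          filter_upwards [Measure.ae_ne volume (2 : ℝ), Measure.ae_ne volume (-1 : ℝ)] with t a b
          exact ⟨a, b⟩
        filter_upwards [hne] with t ⟨ht2, ht1⟩
        have hinv : Filter.Tendsto (fun n : ℕ => (n : ℝ)⁻¹) Filter.atTop (nhds 0) :=
          tendsto_inv_atTop_zero.comp tendsto_natCast_atTop_atTop
        by_cases h : 1 < |t| ∧ |t| < 2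
        · have h0 : t ≠ 0 := by rintro rfl; have h9 := h.1; rw [abs_zero] at h9; linarith
          have lim : ∀ w e : ℝ, e ≠ 0 →
              Filter.Tendsto (fun n : ℕ => W (n * t)) Filter.atTop (nhds w) →
              Filter.Tendsto (fun n : ℕ => d (n * t)) Filter.atTop (nhds e) →
              Filter.Tendsto (fun n : ℕ => (n : ℝ) * B n (n * t)) Filter.atTop
                (nhds (2 * Real.sign t * (2 - |t|) * w / e)) := by
            intro w e he hw hde
            have h5 : Filter.Tendsto (fun n : ℕ => (Real.sign t ^ 2 * (n : ℝ)⁻¹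
                + 2 * Real.sign t * (2 - |t|) * W (n * t)) / d (n * t)) Filter.atTop
                (nhds ((Real.sign t ^ 2 * 0 + 2 * Real.sign t * (2 - |t|) * w) / e)) :=
              ((hinv.const_mul _).add (hw.const_mul _)).div hde he
            rw [mul_zero, zero_add] at h5
            refine h5.congr' ?_
            filter_upwards [Filter.eventually_gt_atTop 0] with n hn
            exact (form n hn t h.1 h.2).symm
          rcases lt_or_gt_of_ne h0 with hneg | hpos
          · have ht : Filter.Tendsto (fun n : ℕ => (n : ℝ) * t) Filter.atTop Filter.atBot :=
              tendsto_natCast_atTop_atTop.atTop_mul_const_of_neg hneg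
            have := lim Wn dn hdn0 (hWn.comp ht) (hdn.comp ht)
            convert this using 2
            rw [abs_of_neg hneg] at h ⊢
            rw [Real.sign_of_neg hneg]
            unfold auxL
            rw [Set.indicator_of_notMem (by rintro ⟨a, b⟩; linarith),
              Set.indicator_of_mem (Set.mem_Ioc.mpr ⟨by linarith [h.2], by linarith [h.1]⟩)]
            ring
          · have ht : Filter.Tendsto (fun n : ℕ => (n : ℝ) * t) Filter.atTop Filter.atTop :=
              tendsto_natCast_atTop_atTop.atTop_mul_const hpos
            have := lim Wp dp hdp0 (hWp.comp ht) (hdp.comp ht)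
            convert this using 2
            rw [abs_of_pos hpos] at h ⊢
            rw [Real.sign_of_pos hpos]
            unfold auxL
            rw [Set.indicator_of_mem (Set.mem_Ioc.mpr ⟨by linarith [h.1], by linarith [h.2]⟩),
              Set.indicator_of_notMem (by rintro ⟨a, b⟩; linarith)]
            ring
        · have hL : auxL (Wp / dp) (Wn / dn) t = 0 := by
            unfold auxL
            rw [Set.indicator_of_notMem, Set.indicator_of_notMem, add_zero]
            · rintro ⟨a, b⟩
              apply h
              have := lt_of_le_of_ne b ht1
              rw [abs_of_neg (by linarith)]
              constructor <;> linarith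
            · rintro ⟨a, b⟩
              apply h
              have := lt_of_le_of_ne b ht2
              rw [abs_of_pos (by linarith)]
              constructor <;> linarith
          rw [hL]
          refine tendsto_const_nhds.congr' ?_
          filter_upwards [Filter.eventually_gt_atTop 0] with n hn
          exact (form0 n hn t h).symm
    refine key.congr' ?_
    filter_upwards [Filter.eventually_gt_atTop 0] with n hn
    exact change n hn

theorem aux_A (F : ℝ → ℝ) (hF : Integrable F) :
    (∀ n, Integrable (fun x => F x * tent n x ^ 2)) ∧
    Filter.Tendsto (fun n : ℕ => ∫ x, F x * tent n x ^ 2) Filter.atTop (nhds (∫ x, F x)) := by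
  have hm : ∀ n, AEStronglyMeasurable (fun x => F x * tent n x ^ 2) :=
    fun n => hF.aestronglyMeasurable.mul ((aux_tent_meas n).pow_const 2).aestronglyMeasurable
  have hb : ∀ n x, ‖F x * tent n x ^ 2‖ ≤ ‖F x‖ := by
    intro n x
    rw [norm_mul, norm_pow, Real.norm_eq_abs (tent n x)]
    exact mul_le_of_le_one_right (norm_nonneg _) (pow_le_one₀ (abs_nonneg _) (aux_tent_abs n x))
  refine ⟨fun n => hF.norm.mono' (hm n) (Filter.Eventually.of_forall (hb n)), ?_⟩
  refine tendsto_integral_of_dominated_convergence _ hm hF.norm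
    (fun n => Filter.Eventually.of_forall (hb n)) (Filter.Eventually.of_forall fun x => ?_)
  refine tendsto_const_nhds.congr' ?_
  filter_upwards [tendsto_natCast_atTop_atTop.eventually_ge_atTop |x|] with n hn
  unfold tent
  rw [if_pos hn]
  ring

theorem stmt12
    (M₁ M₂ W : ℝ → ℝ)
    (hM₁meas : Measurable M₁) (hM₂meas : Measurable M₂) (hWmeas : Measurable W)
    (hM₁bdd : ∃ C, ∀ x, |M₁ x| ≤ C) (hM₂bdd : ∃ C, ∀ x, |M₂ x| ≤ C)
    (hWbdd : ∃ C, ∀ x, |W x| ≤ C)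
    (Wp Wn M1p M1n M2p M2n : ℝ)
    (hWp : Filter.Tendsto W Filter.atTop (nhds Wp))
    (hWn : Filter.Tendsto W Filter.atBot (nhds Wn))
    (hM1p : Filter.Tendsto M₁ Filter.atTop (nhds M1p))
    (hM1n : Filter.Tendsto M₁ Filter.atBot (nhds M1n))
    (hM2p : Filter.Tendsto M₂ Filter.atTop (nhds M2p))
    (hM2n : Filter.Tendsto M₂ Filter.atBot (nhds M2n))
    (m₁ m₂ : ℝ) (hm₁ : m₁ = sInf (Set.range M₁)) (hm₂ : m₂ = sInf (Set.range M₂))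
    (hgap : -m₂ < m₁)
    (lam : ℝ) (hlam : -m₂ < lam)
    (F : ℝ → ℝ)
    (hF : ∀ x, F x = ((M₁ x - lam) * (M₂ x + lam) + (W x) ^ 2) / (M₂ x + lam))
    (hFint : Integrable F) :
    Filter.Tendsto
      (fun n : ℕ => ∫ x : ℝ,
        ((M₁ x - lam) * (tent n x) ^ 2
          + (-(tentDeriv n x) + W x * tent n x) ^ 2 / (M₂ x + lam)))
      Filter.atTop
      (nhds ((∫ x : ℝ, F x) - (Wn / (M2n + lam) - Wp / (M2p + lam)))) := by
  obtain ⟨CW, hCW⟩ := hWbdd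
  obtain ⟨C2, hC2⟩ := hM₂bdd
  have hbb : BddBelow (Set.range M₂) := by
    refine ⟨-C2, ?_⟩
    rintro _ ⟨x, rfl⟩
    exact (abs_le.mp (hC2 x)).1
  have hc : 0 < m₂ + lam := by linarith
  have hdc : ∀ x, m₂ + lam ≤ M₂ x + lam := by
    intro x
    have := csInf_le hbb (Set.mem_range_self x)
    rw [← hm₂] at this
    linarith
  obtain ⟨hA, hA'⟩ := aux_A F hFint
  obtain ⟨hB, hB'⟩ := aux_B W (fun x => M₂ x + lam) hWmeas (hM₂meas.add_const _) CW _ hc hCW hdc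
    Wp Wn (M2p + lam) (M2n + lam) hWp hWn (hM2p.add_const _) (hM2n.add_const _) _ (fun n x => rfl)
  have hsum := hA'.add hB'
  have e : (∫ x : ℝ, F x) - (Wn / (M2n + lam) - Wp / (M2p + lam))
      = (∫ x : ℝ, F x) + (Wp / (M2p + lam) - Wn / (M2n + lam)) := by ring
  rw [e]
  refine hsum.congr' ?_
  filter_upwards [Filter.eventually_gt_atTop 0] with n hn
  rw [← integral_add (hA n) (hB n hn)]
  refine integral_congr_ae (Filter.Eventually.of_forall fun x => ?_)
  have := (lt_of_lt_of_le hc (hdc x)).ne'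
  simp only [hF]
  field_simp
  ring
end

section
/- Define F : ℝ → ℝ by F(x) := ((M₁(x) − λ_{e+})(M₂(x) + λ_{e+}) + W(x)²)/(M₂(x) + λ_{e+}). If λ₋⁺ < λ₊⁺, then F(x) converges as x → +∞ to the strictly positive number ((M_{1+} − λ₋⁺)(M_{2+} + λ₋⁺) + W₊²)/(M_{2+} + λ₋⁺), and hence the positive part F⁺ is not integrable on ℝ; symmetrically, if λ₊⁺ < λ₋⁺ then F has a strictly positive limit as x → −∞ and F⁺ is not integrable on ℝ. Consequently, if F⁺ is integrable on ℝ then λ₊⁺ = λ₋⁺. -/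
open MeasureTheory

lemma aux_key (l : Filter ℝ) (hl : ∀ s ∈ l, volume s = ⊤)
    (M₁ M₂ W F : ℝ → ℝ) (a b w lam c : ℝ)
    (h1 : Filter.Tendsto M₁ l (nhds a)) (h2 : Filter.Tendsto M₂ l (nhds b))
    (hW : Filter.Tendsto W l (nhds w))
    (hlam : lam = (a - b) / 2 + Real.sqrt (((a + b) / 2) ^ 2 + w ^ 2))
    (hpos : 0 < b + c) (hc : c < lam)
    (hF : ∀ x, F x = ((M₁ x - c) * (M₂ x + c) + (W x) ^ 2) / (M₂ x + c)) :
    Filter.Tendsto F l (nhds (((a - c) * (b + c) + w ^ 2) / (b + c)))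
      ∧ 0 < ((a - c) * (b + c) + w ^ 2) / (b + c)
      ∧ ¬ Integrable (fun x => max (F x) 0) := by
  have ht : Filter.Tendsto F l (nhds (((a - c) * (b + c) + w ^ 2) / (b + c))) := by
    rw [show F = fun x => ((M₁ x - c) * (M₂ x + c) + (W x) ^ 2) / (M₂ x + c) from funext hF]
    exact ((((h1.sub_const c).mul (h2.add_const c)).add (hW.pow 2)).div (h2.add_const c) hpos.ne')
  have hp : 0 < ((a - c) * (b + c) + w ^ 2) / (b + c) := by
    apply div_pos _ hpos
    have hr0 := Real.sqrt_nonneg (((a + b) / 2) ^ 2 + w ^ 2)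
    have hr := Real.sq_sqrt (show 0 ≤ ((a + b) / 2) ^ 2 + w ^ 2 by positivity)
    have hge : |(a + b) / 2| ≤ Real.sqrt (((a + b) / 2) ^ 2 + w ^ 2) :=
      Real.abs_le_sqrt (by nlinarith [sq_nonneg w])
    set r := Real.sqrt (((a + b) / 2) ^ 2 + w ^ 2)
    have h3 := le_abs_self ((a + b) / 2)
    have h4 : 0 < lam - c := by linarith
    have h5 : 0 < c - (a - b) / 2 + r := by linarith
    have h6 := mul_pos h4 h5
    rw [hlam] at h6
    nlinarith
  refine ⟨ht, hp, fun hi => ?_⟩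
  set L := ((a - c) * (b + c) + w ^ 2) / (b + c)
  have hev := ht.eventually (lt_mem_nhds (half_lt_self hp))
  have hfin := hi.measure_gt_lt_top (half_pos hp)
  have hle : volume {x | L / 2 < F x} ≤ volume {x | L / 2 < max (F x) 0} :=
    measure_mono fun x (hx : L / 2 < F x) => lt_of_lt_of_le hx (le_max_left _ _)
  rw [hl _ hev] at hle
  exact absurd hfin (not_lt.mpr hle)

lemma aux_lam (a b w : ℝ) : a ≤ (a - b) / 2 + Real.sqrt (((a + b) / 2) ^ 2 + w ^ 2) := by
  have hge : |(a + b) / 2| ≤ Real.sqrt (((a + b) / 2) ^ 2 + w ^ 2) :=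
    Real.abs_le_sqrt (by nlinarith [sq_nonneg w])
  have h3 := le_abs_self ((a + b) / 2)
  linarith

lemma aux_inf (M : ℝ → ℝ) (h : ∃ C, ∀ x, |M x| ≤ C) (x : ℝ) : sInf (Set.range M) ≤ M x := by
  obtain ⟨C, hC⟩ := h
  refine csInf_le ⟨-C, ?_⟩ ⟨x, rfl⟩
  rintro _ ⟨y, rfl⟩
  exact (abs_le.mp (hC y)).1


theorem stmt15
    (M₁ M₂ W : ℝ → ℝ)
    (hM₁meas : Measurable M₁) (hM₂meas : Measurable M₂) (hWmeas : Measurable W)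
    (hM₁bdd : ∃ C, ∀ x, |M₁ x| ≤ C) (hM₂bdd : ∃ C, ∀ x, |M₂ x| ≤ C)
    (hWbdd : ∃ C, ∀ x, |W x| ≤ C)
    (Wp Wn M1p M1n M2p M2n : ℝ)
    (hWp : Filter.Tendsto W Filter.atTop (nhds Wp))
    (hWn : Filter.Tendsto W Filter.atBot (nhds Wn))
    (hM1p : Filter.Tendsto M₁ Filter.atTop (nhds M1p))
    (hM1n : Filter.Tendsto M₁ Filter.atBot (nhds M1n))
    (hM2p : Filter.Tendsto M₂ Filter.atTop (nhds M2p))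
    (hM2n : Filter.Tendsto M₂ Filter.atBot (nhds M2n))
    (m₁ m₂ : ℝ) (hm₁ : m₁ = sInf (Set.range M₁)) (hm₂ : m₂ = sInf (Set.range M₂))
    (hgap : -m₂ < m₁)
    (lamp lamn lame : ℝ)
    (hlamp : lamp = (M1p - M2p) / 2 + Real.sqrt (((M1p + M2p) / 2) ^ 2 + Wp ^ 2))
    (hlamn : lamn = (M1n - M2n) / 2 + Real.sqrt (((M1n + M2n) / 2) ^ 2 + Wn ^ 2))
    (hlame : lame = min lamp lamn)
    (F : ℝ → ℝ)
    (hF : ∀ x, F x = ((M₁ x - lame) * (M₂ x + lame) + (W x) ^ 2) / (M₂ x + lame)) :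
    (lamn < lamp →
      Filter.Tendsto F Filter.atTop
        (nhds (((M1p - lamn) * (M2p + lamn) + Wp ^ 2) / (M2p + lamn)))
      ∧ 0 < ((M1p - lamn) * (M2p + lamn) + Wp ^ 2) / (M2p + lamn)
      ∧ ¬ Integrable (fun x => max (F x) 0))
    ∧ (lamp < lamn →
      Filter.Tendsto F Filter.atBot
        (nhds (((M1n - lamp) * (M2n + lamp) + Wn ^ 2) / (M2n + lamp)))
      ∧ 0 < ((M1n - lamp) * (M2n + lamp) + Wn ^ 2) / (M2n + lamp)
      ∧ ¬ Integrable (fun x => max (F x) 0))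
    ∧ (Integrable (fun x => max (F x) 0) → lamp = lamn) := by
  have i1 : ∀ x, m₁ ≤ M₁ x := fun x => hm₁ ▸ aux_inf M₁ hM₁bdd x
  have i2 : ∀ x, m₂ ≤ M₂ x := fun x => hm₂ ▸ aux_inf M₂ hM₂bdd x
  have a1 : m₁ ≤ M1p := ge_of_tendsto' hM1p i1
  have a2 : m₁ ≤ M1n := ge_of_tendsto' hM1n i1
  have a3 : m₂ ≤ M2p := ge_of_tendsto' hM2p i2
  have a4 : m₂ ≤ M2n := ge_of_tendsto' hM2n i2
  have b1 : M1p ≤ lamp := hlamp ▸ aux_lam M1p M2p Wp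
  have b2 : M1n ≤ lamn := hlamn ▸ aux_lam M1n M2n Wn
  have htop : ∀ s ∈ (Filter.atTop : Filter ℝ), volume s = ⊤ := by
    intro s hs
    obtain ⟨k, hk⟩ := Filter.mem_atTop_sets.mp hs
    exact measure_mono_top (show Set.Ici k ⊆ s from hk) Real.volume_Ici
  have hbot : ∀ s ∈ (Filter.atBot : Filter ℝ), volume s = ⊤ := by
    intro s hs
    obtain ⟨k, hk⟩ := Filter.mem_atBot_sets.mp hs
    exact measure_mono_top (show Set.Iic k ⊆ s from hk) Real.volume_Iic
  have P : lamn < lamp →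
      Filter.Tendsto F Filter.atTop
        (nhds (((M1p - lamn) * (M2p + lamn) + Wp ^ 2) / (M2p + lamn)))
      ∧ 0 < ((M1p - lamn) * (M2p + lamn) + Wp ^ 2) / (M2p + lamn)
      ∧ ¬ Integrable (fun x => max (F x) 0) := by
    intro h
    have e : lame = lamn := by rw [hlame, min_eq_right h.le]
    rw [e] at hF
    exact aux_key _ htop M₁ M₂ W F _ _ _ lamp lamn hM1p hM2p hWp hlamp (by linarith) h hF
  have N : lamp < lamn →
      Filter.Tendsto F Filter.atBot
        (nhds (((M1n - lamp) * (M2n + lamp) + Wn ^ 2) / (M2n + lamp)))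
      ∧ 0 < ((M1n - lamp) * (M2n + lamp) + Wn ^ 2) / (M2n + lamp)
      ∧ ¬ Integrable (fun x => max (F x) 0) := by
    intro h
    have e : lame = lamp := by rw [hlame, min_eq_left h.le]
    rw [e] at hF
    exact aux_key _ hbot M₁ M₂ W F _ _ _ lamn lamp hM1n hM2n hWn hlamn (by linarith) h hF
  refine ⟨P, N, fun hi => ?_⟩
  rcases lt_trichotomy lamp lamn with h | h | h
  · exact absurd hi (N h).2.2
  · exact h
  · exact absurd hi (P h).2.2
end

section
/- Let M > 0, let n ≥ 1 be an integer with n²π²/(8M) ≤ 2M, and let t be a real number with (n−1)²π²/(8M) < t < n²π²/(8M). Then the set {λ ∈ (M − t, M) : tan(ν_i(λ)) = ν_e(λ)/ν_i(λ) or tan(ν_i(λ)) = −ν_i(λ)/ν_e(λ)}, where ν_e(λ) := √(M² − λ²) and ν_i(λ) := √((λ − M + t)(λ + M)), has exactly n elements. -/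
/-- The set of solutions `λ ∈ (M − t, M)` of the eigenvalue conditions
`tan ν_i = ν_e/ν_i` or `tan ν_i = −ν_i/ν_e` for the square-well Dirac operator,
where `ν_e = √(M² − λ²)` and `ν_i = √((λ − M + t)(λ + M))`. -/
def squareWellEigenvalues (M t : ℝ) : Set ℝ :=
  {lam : ℝ | M - t < lam ∧ lam < M ∧
    (Real.tan (Real.sqrt ((lam - M + t) * (lam + M)))
        = Real.sqrt (M ^ 2 - lam ^ 2) / Real.sqrt ((lam - M + t) * (lam + M))
      ∨ Real.tan (Real.sqrt ((lam - M + t) * (lam + M)))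
        = -(Real.sqrt ((lam - M + t) * (lam + M)) / Real.sqrt (M ^ 2 - lam ^ 2)))}

open Real in
lemma tan_cond (x θ : ℝ) (h0 : 0 < θ) (h1 : θ < π / 2) :
    (tan x = sin θ / cos θ ∨ tan x = -(cos θ / sin θ)) ↔ sin (2 * (x - θ)) = 0 := by
  have hs : 0 < sin θ := sin_pos_of_pos_of_lt_pi h0 (by linarith)
  have hc : 0 < cos θ := cos_pos_of_mem_Ioo ⟨by linarith, by linarith⟩
  have e : sin (2 * (x - θ)) = 0 ↔ sin (x - θ) = 0 ∨ cos (x - θ) = 0 := by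
    rw [sin_two_mul]; simp
  rw [e, sin_sub, cos_sub]
  by_cases hx : cos x = 0
  · have hsx : sin x ≠ 0 := by
      intro h
      have := sin_sq_add_cos_sq x
      rw [h, hx] at this; norm_num at this
    have ht : tan x = 0 := by rw [tan_eq_sin_div_cos, hx, div_zero]
    rw [ht, hx]
    have := div_pos hs hc
    have := div_pos hc hs
    constructor
    · rintro (h | h) <;> linarith
    · rintro (h | h)
      · simp [hsx, hc.ne'] at h
      · simp [hsx, hs.ne'] at h
  · rw [tan_eq_sin_div_cos]
    apply or_congr
    · rw [div_eq_div_iff hx hc.ne']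
      constructor <;> intro h <;> linarith
    · rw [← neg_div, div_eq_div_iff hx hs.ne']
      constructor <;> intro h <;> linarith

open Real in
theorem stmt19 (M t : ℝ) (hM : 0 < M) (n : ℕ) (hn : 1 ≤ n)
    (hn2 : (n : ℝ) ^ 2 * Real.pi ^ 2 / (8 * M) ≤ 2 * M)
    (ht₁ : ((n : ℝ) - 1) ^ 2 * Real.pi ^ 2 / (8 * M) < t)
    (ht₂ : t < (n : ℝ) ^ 2 * Real.pi ^ 2 / (8 * M)) :
    (squareWellEigenvalues M t).Finite ∧ (squareWellEigenvalues M t).ncard = n := by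
  have ht : 0 < t := lt_of_le_of_lt (by positivity) ht₁
  have ht2 : t < 2 * M := by linarith
  have hpi := pi_pos
  have hn1 : (1 : ℝ) ≤ n := by exact_mod_cast hn
  set θ : ℝ → ℝ := fun l => arcsin (sqrt ((M - l) / t)) with hθ
  set g : ℝ → ℝ := fun l => sqrt ((l - M + t) * (l + M)) - θ l with hg
  have gcont : Continuous g := by
    simp only [hg, hθ]
    refine Continuous.sub (by fun_prop) (continuous_arcsin.comp (by fun_prop))
  have gmono : StrictMonoOn g (Set.Icc (M - t) M) := by
    intro a ha b hb hab
    obtain ⟨ha1, ha2⟩ := ha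
    obtain ⟨hb1, hb2⟩ := hb
    have h1 : sqrt ((a - M + t) * (a + M)) < sqrt ((b - M + t) * (b + M)) := by
      apply sqrt_lt_sqrt
      · apply mul_nonneg <;> linarith
      · apply mul_lt_mul'' <;> linarith
    have h2 : θ b ≤ θ a := by
      apply monotone_arcsin
      apply sqrt_le_sqrt
      gcongr
    simp only [hg]
    linarith
  have g0 : g (M - t) = -(π / 2) := by
    simp [hg, hθ, ht.ne']
  have g1 : g M = sqrt (t * (M + M)) := by
    simp [hg, hθ]
  have g1lo : ((n : ℝ) - 1) * (π / 2) < g M := by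
    rw [g1]
    apply lt_sqrt_of_sq_lt
    rw [div_lt_iff₀ (by positivity)] at ht₁
    nlinarith
  have g1hi : g M < n * (π / 2) := by
    rw [g1, sqrt_lt' (by positivity)]
    rw [lt_div_iff₀ (by positivity)] at ht₂
    nlinarith
  have key : ∀ l ∈ Set.Ioo (M - t) M, (l ∈ squareWellEigenvalues M t ↔ sin (2 * g l) = 0) := by
    rintro l ⟨hl1, hl2⟩
    have hlM : 0 < l + M := by linarith
    have hp : 0 < (M - l) / t := div_pos (by linarith) ht
    have hp1 : (M - l) / t < 1 := by rw [div_lt_one ht]; linarith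
    have ha : 0 < sqrt ((M - l) / t) := sqrt_pos.2 hp
    have ha1 : sqrt ((M - l) / t) < 1 := by rw [sqrt_lt' one_pos]; simpa using hp1
    have hsin : sin (θ l) = sqrt ((M - l) / t) := sin_arcsin (by linarith) ha1.le
    have hcos : cos (θ l) = sqrt ((l - M + t) / t) := by
      simp only [hθ]
      rw [cos_arcsin, sq_sqrt hp.le]
      congr 1
      field_simp
      ring
    have hr : 0 < sqrt ((l + M) * t) := sqrt_pos.2 (by positivity)
    have he : sqrt (M ^ 2 - l ^ 2) = sin (θ l) * sqrt ((l + M) * t) := by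
      rw [hsin, ← sqrt_mul hp.le]
      congr 1
      field_simp
      ring
    have hi : sqrt ((l - M + t) * (l + M)) = cos (θ l) * sqrt ((l + M) * t) := by
      rw [hcos, ← sqrt_mul (div_nonneg (by linarith) ht.le)]
      congr 1
      field_simp
    have e1 : sqrt (M ^ 2 - l ^ 2) / sqrt ((l - M + t) * (l + M)) = sin (θ l) / cos (θ l) := by
      rw [he, hi, mul_div_mul_right _ _ hr.ne']
    have e2 : sqrt ((l - M + t) * (l + M)) / sqrt (M ^ 2 - l ^ 2) = cos (θ l) / sin (θ l) := by
      rw [he, hi, mul_div_mul_right _ _ hr.ne']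
    have := tan_cond (sqrt ((l - M + t) * (l + M))) (θ l) (arcsin_pos.2 ha)
      (arcsin_lt_pi_div_two.2 ha1)
    rw [← this]
    simp only [squareWellEigenvalues, Set.mem_setOf_eq, e1, e2, hl1, hl2, true_and]
  have sub : squareWellEigenvalues M t ⊆ Set.Ioo (M - t) M := fun l hl => ⟨hl.1, hl.2.1⟩
  have inj : Set.InjOn g (squareWellEigenvalues M t) :=
    gmono.injOn.mono (sub.trans Set.Ioo_subset_Icc_self)
  have hle : M - t ≤ M := by linarith
  have img : g '' squareWellEigenvalues M t
      = (fun k : ℕ => (k : ℝ) * (π / 2)) '' (Finset.range n : Set ℕ) := by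
    ext y
    constructor
    · rintro ⟨l, hl, rfl⟩
      have hI := sub hl
      have hz := (key l hI).1 hl
      obtain ⟨k, hk⟩ := sin_eq_zero_iff.1 hz
      have hlo : g (M - t) < g l := gmono ⟨le_rfl, hle⟩ ⟨hI.1.le, hI.2.le⟩ hI.1
      have hhi : g l < g M := gmono ⟨hI.1.le, hI.2.le⟩ ⟨hle, le_rfl⟩ hI.2
      have k1 : (-1 : ℝ) < k := by
        by_contra h
        push Not at h
        nlinarith
      have k2 : (k : ℝ) < n := by
        by_contra h
        push Not at h
        nlinarith
      have k1' : (-1 : ℤ) < k := by exact_mod_cast k1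
      have k2' : k < (n : ℤ) := by exact_mod_cast k2
      lift k to ℕ using by omega
      refine ⟨k, by simpa using k2', ?_⟩
      push_cast at hk
      show (k : ℝ) * (π / 2) = g l
      linarith
    · rintro ⟨k, hk, rfl⟩
      have hk : k + 1 ≤ n := by simpa using hk
      have hk' : (k : ℝ) + 1 ≤ n := by exact_mod_cast hk
      have hk0 : (0 : ℝ) ≤ k := Nat.cast_nonneg k
      have hmem : (k : ℝ) * (π / 2) ∈ Set.Ioo (g (M - t)) (g M) := by
        constructor
        · rw [g0]; nlinarith
        · nlinarith
      obtain ⟨l, hl, hgl⟩ := intermediate_value_Ioo hle gcont.continuousOn hmem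
      refine ⟨l, (key l hl).2 ?_, hgl⟩
      rw [hgl, show 2 * ((k : ℝ) * (π / 2)) = k * π by ring]
      exact sin_nat_mul_pi k
  constructor
  · apply Set.Finite.of_finite_image _ inj
    rw [img]
    exact (Finset.finite_toSet _).image _
  · rw [← Set.ncard_image_of_injOn inj, img, Set.ncard_image_of_injective, Set.ncard_coe_finset,
      Finset.card_range]
    intro a b hab
    have : (a : ℝ) = b := mul_right_cancel₀ (by positivity) hab
    exact_mod_cast this
end
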